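/- arXiv:1503.05339 — 2 statements merged into one kernel-verified Lean document; each statement's English description precedes it below -/
import Mathlib

section
/- Let L ≥ 3, let p, q ≥ 0, and let N be a nonempty set of perfect matchings of the hexagonal torus T_L that is closed under single-bead up-jumps and down-jumps (for example, a connected component of the elementary-move graph, such as a sector N^L_ρ with fixed height change on the torus). Then the uniform probability measure π on N is stationary for the generator 𝓛: for every σ ∈ N, Σ_{σ' ∈ N} π(σ')·𝓛(σ',σ) = 0. -/
/-!
Dimer coverings (perfect matchings) of the hexagonal torus `T_L`, beads, elementary
moves, and the sets `I⁺_b`, `I⁻_b` of positions available above/below a bead.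

Statement-specific material follows the common setup below.

-/

namespace HexDimer

variable (L : ℕ)

/-- Positions `x ∈ (ℤ/Lℤ)²` indexing the white vertices `w_x`, the black vertices `b_x`,
and the horizontal edges (hence the faces / possible bead positions). -/
abbrev Pos := ZMod L × ZMod L

/-- An edge of the hexagonal torus is encoded by its white endpoint `x` together with a
direction `d : Fin 3`: `d = 0` is the horizontal edge `{w_x, b_x}`, `d = 1` is
`{w_x, b_{x+(1,0)}}`, `d = 2` is `{w_x, b_{x+(0,1)}}`. -/
abbrev Edge := Pos L × Fin 3

/-- The displacement of the black endpoint of an edge in direction `d`. -/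
def dvec : Fin 3 → Pos L := ![(0, 0), (1, 0), (0, 1)]

/-- A configuration: a (finite) set of edges. -/
abbrev Config := Finset (Edge L)

/-- `σ` is a perfect matching of the hexagonal torus: every white vertex `w_x` and every
black vertex `b_x` belongs to exactly one edge of `σ`. -/
def IsPM (σ : Config L) : Prop :=
  (∀ x : Pos L, ∃! d : Fin 3, (x, d) ∈ σ) ∧
  (∀ x : Pos L, ∃! e : Edge L, e ∈ σ ∧ e.1 + dvec L e.2 = x)

/-- The upward shift `(1,-1)` along a column. -/
def u : Pos L := (1, -1)

/-- The set of beads (horizontal dimers) of `σ`, recorded by their positions. -/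
def beadPos (σ : Config L) : Finset (Pos L) :=
  (σ.filter (fun e => e.2 = 0)).image Prod.fst

/-- The alternating triple of edges of the face `F_x` containing the lower horizontal
edge `{w_x, b_x}`: the edges `(x,0)`, `(x+(1,-1),2)` and `(x-(0,1),1)`. -/
def lowTriple (x : Pos L) : Finset (Edge L) :=
  {(x, 0), (x + u L, 2), (x - (0, 1), 1)}

/-- The alternating triple of edges of the face `F_x` containing the upper horizontal
edge `{w_{x+(1,-1)}, b_{x+(1,-1)}}`: the edges `(x,1)`, `(x+(1,-1),0)` and `(x-(0,1),2)`. -/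
def highTriple (x : Pos L) : Finset (Edge L) :=
  {(x, 1), (x + u L, 0), (x - (0, 1), 2)}

/-- The elementary up-move at the face `F_x` is allowed: `σ` contains the alternating
triple through the lower horizontal edge of `F_x` (in particular there is a bead at `x`). -/
def CanUp (σ : Config L) (x : Pos L) : Prop := lowTriple L x ⊆ σ

/-- The configuration after the elementary up-move at `F_x`: the three dimers of the low
triple are rotated onto the high triple; the bead at `x` moves up to `x + (1,-1)`. -/
def upMove (σ : Config L) (x : Pos L) : Config L := (σ \ lowTriple L x) ∪ highTriple L x

/-- The elementary down-move bringing the bead at `x` down to `x - (1,-1)` is allowed. -/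
def CanDown (σ : Config L) (x : Pos L) : Prop := highTriple L (x - u L) ⊆ σ

/-- The configuration after the elementary down-move of the bead at `x`. -/
def downMove (σ : Config L) (x : Pos L) : Config L :=
  (σ \ highTriple L (x - u L)) ∪ lowTriple L (x - u L)

/-- `UpPath σ x y σ'` holds if, starting from `σ` with a bead at `x`, a concatenation of
elementary up-moves (each moving this bead and no other bead) brings the bead to
position `y`, the configuration becoming `σ'`. -/
inductive UpPath : Config L → Pos L → Pos L → Config L → Prop
  | refl (σ : Config L) (x : Pos L) : UpPath σ x x σ
  | step {σ : Config L} {x y : Pos L} {σ' : Config L} :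
      CanUp L σ x → UpPath (upMove L σ x) (x + u L) y σ' → UpPath σ x y σ'

/-- `DownPath σ x y σ'`: a concatenation of elementary down-moves of a single bead brings
it from `x` to `y`, the configuration becoming `σ'`. -/
inductive DownPath : Config L → Pos L → Pos L → Config L → Prop
  | refl (σ : Config L) (x : Pos L) : DownPath σ x x σ
  | step {σ : Config L} {x y : Pos L} {σ' : Config L} :
      CanDown L σ x → DownPath (downMove L σ x) (x - u L) y σ' → DownPath σ x y σ'

/-- `I⁺_b(σ)`: the set of positions available above the bead at `x`. -/
def Iplus (σ : Config L) (x : Pos L) : Set (Pos L) :=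
  {y | y ≠ x ∧ ∃ σ' : Config L, UpPath L σ x y σ'}

/-- `I⁻_b(σ)`: the set of positions available below the bead at `x`. -/
def Iminus (σ : Config L) (x : Pos L) : Set (Pos L) :=
  {y | y ≠ x ∧ ∃ σ' : Config L, DownPath L σ x y σ'}


/-- `τ` is obtained from `σ` by a single-bead up-jump: some bead moves from its position
`x` to a position `y ∈ I⁺` strictly above it, via a concatenation of elementary up-moves
moving no other bead. -/
def IsUpJump (σ τ : Config L) : Prop :=
  ∃ x y : Pos L, y ≠ x ∧ UpPath L σ x y τ

/-- `τ` is obtained from `σ` by a single-bead down-jump. -/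
def IsDownJump (σ τ : Config L) : Prop :=
  ∃ x y : Pos L, y ≠ x ∧ DownPath L σ x y τ

/-- The number of up-jumps from `σ` yielding `τ` (counted by the pair
(initial position, final position) of the jumping bead). -/
noncomputable def numUpJumps (σ τ : Config L) : ℕ :=
  Set.ncard {pr : Pos L × Pos L | pr.2 ≠ pr.1 ∧ UpPath L σ pr.1 pr.2 τ}

/-- The number of down-jumps from `σ` yielding `τ`. -/
noncomputable def numDownJumps (σ τ : Config L) : ℕ :=
  Set.ncard {pr : Pos L × Pos L | pr.2 ≠ pr.1 ∧ DownPath L σ pr.1 pr.2 τ}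

/-- The generator `𝓛` of the bead dynamics with rates `p` (up) and `q` (down):
for `τ ≠ σ`, `𝓛(σ,τ) = p·#{up-jumps σ → τ} + q·#{down-jumps σ → τ}`, and
`𝓛(σ,σ) = −∑_{τ ≠ σ} 𝓛(σ,τ)`. -/
noncomputable def Gen [NeZero L] (p q : ℝ) (σ τ : Config L) : ℝ :=
  if τ = σ then
    -∑ τ' ∈ Finset.univ.erase σ, (p * numUpJumps L σ τ' + q * numDownJumps L σ τ')
  else p * numUpJumps L σ τ + q * numDownJumps L σ τ

variable {L}

@[simp] lemma dvec_zero : dvec L 0 = 0 := rfl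

/-! ### Local consequences of being a perfect matching -/

section Matching

variable {σ : Config L}

lemma IsPM.dir_unique (h : IsPM L σ) {x : Pos L} {d d' : Fin 3} (hd : (x, d) ∈ σ)
    (hd' : (x, d') ∈ σ) : d = d' :=
  (h.1 x).unique hd hd'

lemma IsPM.dir_unique_black (h : IsPM L σ) {x y : Pos L} {d d' : Fin 3} (hd : (x, d) ∈ σ)
    (hd' : (y, d') ∈ σ) (hxy : x + dvec L d = y + dvec L d') : d = d' :=
  congrArg Prod.snd ((h.2 (x + dvec L d)).unique ⟨hd, rfl⟩ ⟨hd', hxy.symm⟩)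

lemma IsPM.white_cover (h : IsPM L σ) (x : Pos L) :
    (x, (0 : Fin 3)) ∈ σ ∨ (x, (1 : Fin 3)) ∈ σ ∨ (x, (2 : Fin 3)) ∈ σ := by
  obtain ⟨d, hd, -⟩ := h.1 x
  fin_cases d <;> simp_all

lemma IsPM.black_cover (h : IsPM L σ) (x : Pos L) :
    (x, (0 : Fin 3)) ∈ σ ∨ (x - (1, 0), (1 : Fin 3)) ∈ σ ∨ (x - (0, 1), (2 : Fin 3)) ∈ σ := by
  obtain ⟨⟨y, d⟩, ⟨hd, rfl⟩, -⟩ := h.2 x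
  fin_cases d
  · exact .inl (by simpa using hd)
  · exact .inr (.inl (by simpa [dvec] using hd))
  · exact .inr (.inr (by simpa [dvec] using hd))

lemma IsPM.not_bead_of_two (h : IsPM L σ) {x : Pos L} (h2 : (x, (2 : Fin 3)) ∈ σ) :
    (x, (0 : Fin 3)) ∉ σ :=
  fun h0 => absurd (h.dir_unique h0 h2) (by decide)

end Matching

/-- The face `F_x` carries the two non-horizontal dimers of its low triple: a bead below it can
slide up through it. -/
def UpOpen (σ : Config L) (x : Pos L) : Prop :=
  (x + u L, (2 : Fin 3)) ∈ σ ∧ (x - (0, 1), (1 : Fin 3)) ∈ σ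

/-- The face `F_x` carries the two non-horizontal dimers of its high triple: a bead above it can
slide down through it. -/
def DownOpen (σ : Config L) (x : Pos L) : Prop :=
  (x, (1 : Fin 3)) ∈ σ ∧ (x - (0, 1), (2 : Fin 3)) ∈ σ

lemma canUp_iff {σ : Config L} {x : Pos L} : CanUp L σ x ↔ (x, 0) ∈ σ ∧ UpOpen σ x := by
  simp [CanUp, lowTriple, UpOpen, Finset.insert_subset_iff]

open Classical in
/-- A perfect matching has as many faces open upwards as faces open downwards. -/
lemma IsPM.card_upOpen_eq [NeZero L] {σ : Config L} (h : IsPM L σ) :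
    (Finset.univ.filter (UpOpen σ)).card = (Finset.univ.filter (DownOpen σ)).card := by
  have key : ∀ z : Pos L, ((if UpOpen σ (z - u L) then 1 else 0 : ℕ) : ℤ)
      - ((if DownOpen σ z then 1 else 0 : ℕ) : ℤ)
      = (if (z - (1, 0), (1 : Fin 3)) ∈ σ then 1 else 0)
        - (if (z, (1 : Fin 3)) ∈ σ then 1 else 0) := by
    intro z
    have e : z - u L - (0, 1) = z - (1, 0) := by ext <;> simp [u]
    have w01 : (z, (0 : Fin 3)) ∈ σ → (z, (1 : Fin 3)) ∉ σ :=
      fun a b => absurd (h.dir_unique a b) (by decide)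
    have w02 : (z, (0 : Fin 3)) ∈ σ → (z, (2 : Fin 3)) ∉ σ :=
      fun a b => absurd (h.dir_unique a b) (by decide)
    have w12 : (z, (1 : Fin 3)) ∈ σ → (z, (2 : Fin 3)) ∉ σ :=
      fun a b => absurd (h.dir_unique a b) (by decide)
    have b01 : (z, (0 : Fin 3)) ∈ σ → (z - (1, 0), (1 : Fin 3)) ∉ σ :=
      fun a b => absurd (h.dir_unique_black a b (by simp [dvec])) (by decide)
    have b12 : (z - (1, 0), (1 : Fin 3)) ∈ σ → (z - (0, 1), (2 : Fin 3)) ∉ σ :=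
      fun a b => absurd (h.dir_unique_black a b (by simp [dvec])) (by decide)
    have cw := h.white_cover z
    have cb := h.black_cover z
    simp only [UpOpen, DownOpen, sub_add_cancel, e]
    by_cases h0 : (z, (0 : Fin 3)) ∈ σ <;> by_cases h1 : (z, (1 : Fin 3)) ∈ σ <;>
      by_cases h2 : (z, (2 : Fin 3)) ∈ σ <;>
      by_cases h3 : (z - (1, 0), (1 : Fin 3)) ∈ σ <;>
      by_cases h4 : (z - (0, 1), (2 : Fin 3)) ∈ σ <;> simp_all
  have hsum := Finset.sum_congr rfl (fun z (_ : z ∈ (Finset.univ : Finset (Pos L))) => key z)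
  have shift_one := Equiv.sum_comp (Equiv.subRight (1, 0) : Pos L ≃ Pos L)
    (fun z => if (z, (1 : Fin 3)) ∈ σ then (1 : ℤ) else 0)
  have shift_u := Equiv.sum_comp (Equiv.subRight (u L) : Pos L ≃ Pos L)
    (fun z => ((if UpOpen σ z then 1 else 0 : ℕ) : ℤ))
  simp only [Equiv.subRight_apply] at shift_one shift_u
  rw [Finset.sum_sub_distrib, Finset.sum_sub_distrib, shift_one, shift_u, sub_self,
    ← Nat.cast_sum, ← Nat.cast_sum, sub_eq_zero] at hsum
  rw [Finset.card_filter, Finset.card_filter]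
  exact_mod_cast hsum

/-! ### Every column contains a bead as soon as there is one -/

lemma nsmul_u (k : ℕ) : k • u L = ((k : ZMod L), -(k : ZMod L)) := by
  ext <;> simp [u]

lemma card_nsmul_u : L • u L = 0 := by
  rw [nsmul_u]; ext <;> simp

lemma nsmul_u_injOn {k k' : ℕ} (hk : k < L) (hk' : k' < L) (h : k • u L = k' • u L) : k = k' := by
  rw [nsmul_u, nsmul_u, Prod.mk.injEq, ZMod.natCast_eq_natCast_iff] at h
  exact Nat.ModEq.eq_of_lt_of_lt h.1 hk hk'

lemma IsPM.bead_left_column {σ : Config L} (h : IsPM L σ) (hL : 0 < L) {z : Pos L}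
    (hz : (z + (1, 0), (0 : Fin 3)) ∈ σ) : ∃ k : ℕ, (z + k • u L, (0 : Fin 3)) ∈ σ := by
  by_contra! hno
  have one : ∀ n : ℕ, (z + (n + 1) • u L, (1 : Fin 3)) ∈ σ := by
    intro n
    induction n with
    | zero =>
      rcases h.white_cover (z + (0 + 1) • u L) with h0 | h1 | h2
      · exact absurd h0 (hno _)
      · exact h1
      · exact absurd (h.dir_unique_black hz h2 (by ext <;> simp [dvec, u])) (by decide)
    | succ n ih =>
      rcases h.white_cover (z + (n + 1 + 1) • u L) with h0 | h1 | h2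
      · exact absurd h0 (hno _)
      · exact h1
      · exact absurd (h.dir_unique_black ih h2
          (by rw [succ_nsmul (u L) (n + 1)]; ext <;> simp [dvec, u] <;> ring)) (by decide)
  have := one (L - 1)
  rw [Nat.sub_add_cancel hL, card_nsmul_u, add_zero] at this
  exact absurd (h.dir_unique_black hz this (by simp [dvec])) (by decide)

lemma IsPM.bead_in_column [NeZero L] {σ : Config L} (h : IsPM L σ) {x : Pos L}
    (hx : (x, (0 : Fin 3)) ∈ σ) (z : Pos L) : ∃ k : ℕ, (z + k • u L, (0 : Fin 3)) ∈ σ := by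
  have shift : ∀ (a : ℕ) (z : Pos L), (∃ k : ℕ, (z + a • (1, 0) + k • u L, (0 : Fin 3)) ∈ σ) →
      ∃ k : ℕ, (z + k • u L, (0 : Fin 3)) ∈ σ := by
    intro a
    induction a with
    | zero => intro z; simp
    | succ a ih =>
      rintro z ⟨k, hk⟩
      apply ih
      obtain ⟨m, hm⟩ := h.bead_left_column (NeZero.pos L)
        (z := z + a • (1, 0) + k • u L) (by
          convert hk using 2
          rw [succ_nsmul]; abel)
      exact ⟨k + m, by rwa [add_nsmul, ← add_assoc]⟩
  refine shift ((x.1 + x.2) - (z.1 + z.2)).val z ⟨(z.2 - x.2).val, ?_⟩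
  convert hx using 2
  rw [nsmul_u]
  ext <;> simp
  ring

/-! ### Up-paths -/

/-- The first `k` faces above position `x` are open upwards, and (if `k > 0`) there is a bead at
`x`. -/
def Climb (σ : Config L) (x : Pos L) (k : ℕ) : Prop :=
  ∀ i < k, (x, 0) ∈ σ ∧ UpOpen σ (x + i • u L)

/-- The result of `k` successive up-moves of the bead at `x`. -/
def iterUp : ℕ → Config L → Pos L → Config L
  | 0, σ, _ => σ
  | k + 1, σ, x => iterUp k (upMove L σ x) (x + u L)

lemma nsmul_u_ne_zero {k : ℕ} (h0 : 0 < k) (hk : k < L) : k • u L ≠ 0 := by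
  intro h
  have := nsmul_u_injOn hk (h0.trans hk) (h.trans (zero_nsmul _).symm)
  omega

lemma upOpen_upMove_iff (hL : 3 ≤ L) {σ : Config L} {x : Pos L} {i : ℕ} (h0 : 0 < i)
    (hi : i < L) : UpOpen (upMove L σ x) (x + i • u L) ↔ UpOpen σ (x + i • u L) := by
  have hne := nsmul_u_ne_zero h0 hi
  have : Fact (1 < L) := ⟨by omega⟩
  have e1 : x + i • u L + u L ≠ x + u L := by
    intro h; apply hne; simpa using h
  have e2 : x + i • u L + u L ≠ x - (0, 1) := by
    intro h
    have := congrArg (fun t : Pos L => t.1 + t.2) h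
    rw [nsmul_u] at this
    simp only [u, Prod.fst_add, Prod.snd_add, Prod.fst_sub, Prod.snd_sub] at this
    exact one_ne_zero (α := ZMod L) (by linear_combination this)
  have e3 : x + i • u L - (0, 1) ≠ x - (0, 1) := by
    intro h; apply hne; simpa using h
  have e4 : x + i • u L - (0, 1) ≠ x := by
    intro h
    have := congrArg (fun t : Pos L => t.1 + t.2) h
    rw [nsmul_u] at this
    simp only [Prod.fst_add, Prod.snd_add, Prod.fst_sub, Prod.snd_sub] at this
    exact one_ne_zero (α := ZMod L) (by linear_combination -this)
  simp [-nsmul_eq_mul, UpOpen, upMove, lowTriple, highTriple, e1, e2, e3, e4]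

lemma climb_succ_iff (hL : 3 ≤ L) {σ : Config L} {x : Pos L} {k : ℕ} (hk : k + 1 ≤ L) :
    Climb σ x (k + 1) ↔ CanUp L σ x ∧ Climb (upMove L σ x) (x + u L) k := by
  have hstep : ∀ i < k, (UpOpen (upMove L σ x) (x + u L + i • u L) ↔
      UpOpen σ (x + (i + 1) • u L)) := by
    intro i hi
    rw [← upOpen_upMove_iff hL (Nat.succ_pos i) (by omega : i + 1 < L), add_assoc, succ_nsmul']
  have hbead : (x + u L, (0 : Fin 3)) ∈ upMove L σ x := by simp [upMove, highTriple]
  constructor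
  · intro h
    refine ⟨canUp_iff.2 (by simpa using h 0 (Nat.succ_pos k)), fun i hi => ⟨hbead, ?_⟩⟩
    exact (hstep i hi).2 (h (i + 1) (by omega)).2
  · rintro ⟨h0, h⟩ i hi
    refine ⟨(canUp_iff.1 h0).1, ?_⟩
    cases i with
    | zero => simpa using (canUp_iff.1 h0).2
    | succ i => exact (hstep i (by omega)).1 (h i (by omega)).2

lemma upPath_of_climb (hL : 3 ≤ L) {k : ℕ} (hk : k ≤ L) {σ : Config L} {x : Pos L}
    (h : Climb σ x k) : UpPath L σ x (x + k • u L) (iterUp k σ x) := by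
  induction k generalizing σ x with
  | zero => simpa [iterUp] using UpPath.refl σ x
  | succ k ih =>
    obtain ⟨h0, h⟩ := (climb_succ_iff hL hk).1 h
    refine .step h0 ?_
    rw [succ_nsmul', ← add_assoc]
    exact ih (by omega) h

lemma UpPath.exists_climb_min (hL : 3 ≤ L) {σ τ : Config L} {x y : Pos L}
    (h : UpPath L σ x y τ) : ∃ k : ℕ, y = x + k • u L ∧ τ = iterUp k σ x ∧
      ∀ j ≤ k, j ≤ L → Climb σ x j := by
  induction h with
  | refl σ x => exact ⟨0, by simp, rfl, fun j hj _ i hi => by omega⟩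
  | @step σ x y τ h0 _ ih =>
    obtain ⟨k, rfl, rfl, hk⟩ := ih
    refine ⟨k + 1, by rw [succ_nsmul', ← add_assoc], rfl, fun j hj hjL => ?_⟩
    cases j with
    | zero => exact fun i hi => by omega
    | succ j => exact (climb_succ_iff hL hjL).2 ⟨h0, hk j (by omega) (by omega)⟩

lemma IsPM.exists_climb (hL : 3 ≤ L) {σ τ : Config L} (hσ : IsPM L σ) {x y : Pos L}
    (h : UpPath L σ x y τ) :
    ∃ k < L, y = x + k • u L ∧ τ = iterUp k σ x ∧ Climb σ x k := by
  obtain ⟨k, hy, hτ, hk⟩ := h.exists_climb_min hL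
  have hlt : k < L := by
    by_contra! hle
    have := hk L hle le_rfl (L - 1) (by omega)
    have h2 := this.2.1
    rw [add_assoc, ← succ_nsmul, Nat.sub_add_cancel (by omega), card_nsmul_u, add_zero] at h2
    exact hσ.not_bead_of_two h2 this.1
  exact ⟨k, hlt, hy, hτ, hk k le_rfl hlt.le⟩

lemma IsPM.upPath_unique (hL : 3 ≤ L) {σ τ τ' : Config L} (hσ : IsPM L σ) {x y : Pos L}
    (h : UpPath L σ x y τ) (h' : UpPath L σ x y τ') : τ = τ' := by
  obtain ⟨k, hk, rfl, rfl, -⟩ := hσ.exists_climb hL h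
  obtain ⟨k', hk', hy, rfl, -⟩ := hσ.exists_climb hL h'
  rw [nsmul_u_injOn hk hk' (add_left_cancel hy)]

lemma UpPath.bead_end {σ τ : Config L} {x y : Pos L} (h : UpPath L σ x y τ)
    (hx : (x, (0 : Fin 3)) ∈ σ) : (y, (0 : Fin 3)) ∈ τ := by
  induction h with
  | refl => exact hx
  | step _ _ ih => exact ih (by simp [upMove, highTriple])

/-- A nontrivial climb ends at a position whose lower face is open upwards. -/
lemma Climb.top {σ : Config L} {x : Pos L} {k : ℕ} (h : Climb σ x k) (hk : 0 < k) :
    (x, 0) ∈ σ ∧ UpOpen σ (x + k • u L - u L) := by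
  obtain ⟨k, rfl⟩ := Nat.exists_eq_succ_of_ne_zero hk.ne'
  have := h k (by omega)
  rwa [succ_nsmul, ← add_assoc, add_sub_cancel_right]

lemma UpOpen.two {σ : Config L} {y : Pos L} (h : UpOpen σ (y - u L)) :
    (y, (2 : Fin 3)) ∈ σ := by
  simpa using h.1

lemma IsPM.upPath_ne (hL : 3 ≤ L) {σ τ : Config L} (hσ : IsPM L σ) {x y : Pos L}
    (h : UpPath L σ x y τ) (hxy : y ≠ x) : τ ≠ σ := by
  rintro rfl
  obtain ⟨k, -, rfl, -, hk⟩ := hσ.exists_climb hL h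
  have hk0 : 0 < k := Nat.pos_of_ne_zero (by rintro rfl; simp at hxy)
  obtain ⟨h0, h1⟩ := hk.top hk0
  exact hσ.not_bead_of_two h1.two (h.bead_end h0)

/-- A face open upwards that has no bead at its bottom lies above a face open upwards. -/
lemma IsPM.upOpen_below {σ : Config L} (hσ : IsPM L σ) {z : Pos L} (h : UpOpen σ z)
    (h0 : (z, (0 : Fin 3)) ∉ σ) : UpOpen σ (z - u L) := by
  refine ⟨?_, ?_⟩
  · rw [sub_add_cancel]
    rcases hσ.white_cover z with h' | h' | h'
    · exact absurd h' h0
    · exact absurd (hσ.dir_unique_black h' h.1 (by ext <;> simp [dvec, u])) (by decide)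
    · exact h'
  · have e : z - u L - (0, 1) = z - (1, 0) := by ext <;> simp [u]
    rw [e]
    rcases hσ.black_cover z with h' | h' | h'
    · exact absurd h' h0
    · exact h'
    · exact absurd (hσ.dir_unique h' h.2) (by decide)

lemma IsPM.exists_climb_to [NeZero L] {σ : Config L} (hσ : IsPM L σ) {b z : Pos L}
    (hb : (b, (0 : Fin 3)) ∈ σ) (hz : UpOpen σ z) :
    ∃ k < L, Climb σ (z - k • u L) (k + 1) := by
  classical
  have hex : ∃ k : ℕ, (z - k • u L, (0 : Fin 3)) ∈ σ := by
    obtain ⟨k, hk⟩ := hσ.bead_in_column hb z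
    refine ⟨(-(k : ZMod L)).val, ?_⟩
    convert hk using 2
    rw [nsmul_u, nsmul_u]
    ext <;> simp [sub_eq_add_neg]
  have hlt : Nat.find hex < L := by
    by_contra! hle
    refine Nat.find_min hex (m := Nat.find hex - L) (by have := NeZero.pos L; omega) ?_
    have := Nat.find_spec hex
    rwa [← Nat.sub_add_cancel hle, add_nsmul, card_nsmul_u, add_zero] at this
  have hopen : ∀ j ≤ Nat.find hex, UpOpen σ (z - j • u L) := by
    intro j
    induction j with
    | zero => intro _; simpa using hz
    | succ j ih =>
      intro hj
      have := hσ.upOpen_below (ih (by omega)) (Nat.find_min hex (by omega))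
      rwa [succ_nsmul, ← sub_sub]
  refine ⟨_, hlt, fun i hi => ⟨Nat.find_spec hex, ?_⟩⟩
  convert hopen (Nat.find hex - i) (by omega) using 1
  conv_lhs => rw [← Nat.sub_add_cancel (Nat.le_of_lt_succ hi), add_nsmul]
  abel

open Classical in
/-- The total number of up-jumps from a perfect matching, as a count of pairs of positions. -/
lemma IsPM.sum_numUpJumps [NeZero L] (hL : 3 ≤ L) {σ : Config L} (hσ : IsPM L σ) :
    ∑ τ ∈ Finset.univ.erase σ, numUpJumps L σ τ =
      (Finset.univ.filter (fun pr : Pos L × Pos L =>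
        pr.2 ≠ pr.1 ∧ ∃ τ, UpPath L σ pr.1 pr.2 τ)).card := by
  have hnum : ∀ τ, numUpJumps L σ τ = (Finset.univ.filter (fun pr : Pos L × Pos L =>
      pr.2 ≠ pr.1 ∧ UpPath L σ pr.1 pr.2 τ)).card := by
    intro τ
    rw [numUpJumps, Set.ncard_eq_toFinset_card']
    congr 1
    ext; simp
  simp_rw [hnum]
  rw [← Finset.card_biUnion]
  · congr 1
    ext pr
    simp only [Finset.mem_biUnion, Finset.mem_erase, Finset.mem_univ, and_true,
      Finset.mem_filter, true_and]
    constructor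
    · rintro ⟨τ, -, h, hp⟩
      exact ⟨h, τ, hp⟩
    · rintro ⟨h, τ, hp⟩
      exact ⟨τ, hσ.upPath_ne hL hp h, h, hp⟩
  · intro τ _ τ' _ hne
    rw [Function.onFun, Finset.disjoint_left]
    intro pr h h'
    simp only [Finset.mem_filter] at h h'
    exact hne (hσ.upPath_unique hL h.2.2 h'.2.2)

open Classical in
lemma IsPM.sum_numUpJumps_eq_card_upOpen [NeZero L] (hL : 3 ≤ L) {σ : Config L}
    (hσ : IsPM L σ) {b : Pos L} (hb : (b, (0 : Fin 3)) ∈ σ) :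
    ∑ τ ∈ Finset.univ.erase σ, numUpJumps L σ τ = (Finset.univ.filter (UpOpen σ)).card := by
  have data : ∀ pr : Pos L × Pos L, (pr.2 ≠ pr.1 ∧ ∃ τ, UpPath L σ pr.1 pr.2 τ) →
      ∃ k : ℕ, 0 < k ∧ pr.2 = pr.1 + k • u L ∧ Climb σ pr.1 k := by
    rintro ⟨x, y⟩ ⟨hne, τ, h⟩
    obtain ⟨k, -, hy, -, hk⟩ := hσ.exists_climb hL h
    refine ⟨k, Nat.pos_of_ne_zero ?_, hy, hk⟩
    rintro rfl
    exact hne (by simpa using hy)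
  rw [hσ.sum_numUpJumps hL]
  refine Finset.card_bij (fun pr _ => pr.2 - u L) ?_ ?_ ?_
  · intro pr hpr
    obtain ⟨k, hk0, hy, hk⟩ := data pr (by simpa using hpr)
    rw [Finset.mem_filter, hy]
    exact ⟨Finset.mem_univ _, (hk.top hk0).2⟩
  · intro pr hpr pr' hpr' heq
    obtain ⟨k, hk0, hy, hk⟩ := data pr (by simpa using hpr)
    obtain ⟨k', hk0', hy', hk'⟩ := data pr' (by simpa using hpr')
    have h2 : pr.2 = pr'.2 := sub_left_injective heq
    have aux : ∀ {x x' : Pos L} {k k' : ℕ}, 0 < k → Climb σ x k → Climb σ x' k' →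
        x + k • u L = x' + k' • u L → k' ≤ k := by
      intro x x' k k' hk0 hk hk' h
      by_contra! hlt
      have hx : x = x' + (k' - k) • u L := by
        rw [← Nat.sub_add_cancel hlt.le, add_nsmul, ← add_assoc] at h
        exact add_right_cancel h
      have hc : Climb σ x' (k' - k) := fun i hi => hk' i (by omega)
      have := (hc.top (by omega)).2
      rw [← hx] at this
      exact hσ.not_bead_of_two this.two (hk 0 hk0).1
    have h3 : pr.1 + k • u L = pr'.1 + k' • u L := by rw [← hy, ← hy', h2]
    obtain rfl : k = k' := le_antisymm (aux hk0' hk' hk h3.symm) (aux hk0 hk hk' h3)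
    exact Prod.ext (add_right_cancel h3) h2
  · intro z hz
    obtain ⟨k, hkL, hk⟩ := hσ.exists_climb_to hb (by simpa using hz)
    have hy : z - k • u L + (k + 1) • u L = z + u L := by rw [succ_nsmul]; abel
    have hp := upPath_of_climb hL hkL hk
    rw [hy] at hp
    refine ⟨(z - k • u L, z + u L), ?_, add_sub_cancel_right _ _⟩
    rw [Finset.mem_filter]
    refine ⟨Finset.mem_univ _, fun he => ?_, _, hp⟩
    have h1 := (hk 0 (Nat.succ_pos k)).1
    rw [← show z + u L = z - k • u L from he] at h1
    rw [Finset.mem_filter] at hz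
    exact hσ.not_bead_of_two hz.2.1 h1

lemma sum_numUpJumps_eq_zero [NeZero L] {σ : Config L}
    (h0 : ∀ b : Pos L, (b, (0 : Fin 3)) ∉ σ) :
    ∑ τ ∈ Finset.univ.erase σ, numUpJumps L σ τ = 0 := by
  refine Finset.sum_eq_zero fun τ _ => ?_
  rw [numUpJumps, Set.ncard_eq_zero]
  rw [Set.eq_empty_iff_forall_notMem]
  rintro ⟨x, y⟩ ⟨hne, h⟩
  cases h with
  | refl => exact hne rfl
  | step hc _ => exact h0 x (canUp_iff.1 hc).1

/-! ### Half-turn symmetry -/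

/-- The half-turn of the torus, exchanging `w_x` and `b_{-x}`, acting on edges. -/
def halfTurn : Equiv.Perm (Edge L) :=
  Function.Involutive.toPerm (fun e => (-(e.1 + dvec L e.2), e.2)) (fun e => by simp)

/-- The half-turn acting on configurations. -/
def turn : Equiv.Perm (Config L) := halfTurn.finsetCongr

lemma mem_turn {σ : Config L} {e : Edge L} : e ∈ turn σ ↔ halfTurn e ∈ σ := by
  simp only [turn, Equiv.finsetCongr_apply, Finset.mem_map_equiv]
  rfl

lemma halfTurn_apply (x : Pos L) (d : Fin 3) :
    halfTurn (x, d) = (-(x + dvec L d), d) := rfl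

lemma turn_turn (σ : Config L) : turn (turn σ) = σ := by
  ext ⟨x, d⟩
  simp [mem_turn, halfTurn_apply]

lemma bead_mem_turn {σ : Config L} {x : Pos L} :
    (x, (0 : Fin 3)) ∈ turn σ ↔ (-x, (0 : Fin 3)) ∈ σ := by
  simp [mem_turn, halfTurn_apply]

lemma IsPM.turn {σ : Config L} (h : IsPM L σ) : IsPM L (turn σ) := by
  refine ⟨fun x => ?_, fun x => ?_⟩
  · obtain ⟨⟨y, d⟩, ⟨hd, hy⟩, huniq⟩ := h.2 (-x)
    refine ⟨d, ?_, fun d' hd' => ?_⟩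
    · simp only [mem_turn, halfTurn_apply]
      convert hd using 2
      rw [neg_add, ← hy]
      exact add_neg_cancel_right y (dvec L d)
    · simp only [mem_turn, halfTurn_apply] at hd'
      exact congrArg Prod.snd (huniq _ ⟨hd', by simp⟩)
  · obtain ⟨d, hd, huniq⟩ := h.1 (-x)
    refine ⟨halfTurn (-x, d), ⟨?_, ?_⟩, ?_⟩
    · simpa [mem_turn, halfTurn_apply] using hd
    · simp [halfTurn_apply]
    · rintro ⟨y, d'⟩ ⟨hd', rfl⟩
      simp only [mem_turn, halfTurn_apply] at hd'
      obtain rfl := huniq d' hd'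
      simp [halfTurn_apply]

lemma turn_lowTriple (x : Pos L) : turn (lowTriple L x) = highTriple L (-x - u L) := by
  ext ⟨⟨a, b⟩, d⟩
  fin_cases d <;>
    simp [mem_turn, halfTurn_apply, lowTriple, highTriple, dvec, u, Prod.ext_iff] <;> grind

lemma turn_highTriple (x : Pos L) : turn (highTriple L (x - u L)) = lowTriple L (-x) := by
  rw [← turn_turn (lowTriple L (-x)), turn_lowTriple, neg_neg]

lemma turn_union (σ τ : Config L) : turn (σ ∪ τ) = turn σ ∪ turn τ := by
  ext e; simp [mem_turn]

lemma turn_sdiff (σ τ : Config L) : turn (σ \ τ) = turn σ \ turn τ := by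
  ext e; simp [mem_turn]

lemma turn_subset {σ τ : Config L} : turn σ ⊆ turn τ ↔ σ ⊆ τ := by
  simp [turn]

lemma upMove_turn (σ : Config L) (x : Pos L) :
    upMove L (turn σ) (-x) = turn (downMove L σ x) := by
  rw [downMove, turn_union, turn_sdiff, turn_highTriple, turn_lowTriple, upMove, neg_sub,
    sub_sub_cancel_left]

lemma canUp_turn {σ : Config L} {x : Pos L} : CanUp L (turn σ) (-x) ↔ CanDown L σ x := by
  rw [CanUp, CanDown, ← turn_highTriple, turn_subset]

lemma DownPath.turn {σ τ : Config L} {x y : Pos L} (h : DownPath L σ x y τ) :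
    UpPath L (turn σ) (-x) (-y) (turn τ) := by
  induction h with
  | refl => exact .refl _ _
  | step hc _ ih =>
    refine .step (canUp_turn.2 hc) ?_
    rwa [upMove_turn, neg_add_eq_sub, ← neg_sub]

lemma UpPath.turn {σ τ : Config L} {x y : Pos L} (h : UpPath L σ x y τ) :
    DownPath L (turn σ) (-x) (-y) (turn τ) := by
  induction h with
  | refl => exact .refl _ _
  | @step σ x y τ hc _ ih =>
    refine .step (canUp_turn.1 (by rwa [turn_turn, neg_neg])) ?_
    rwa [← turn_turn (downMove L _ _), ← upMove_turn, turn_turn, neg_neg, ← neg_add']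

lemma numDownJumps_eq (σ τ : Config L) :
    numDownJumps L σ τ = numUpJumps L (turn σ) (turn τ) := by
  rw [numDownJumps, numUpJumps,
    ← Set.ncard_image_of_injective _ (neg_injective (G := Pos L × Pos L))]
  congr 1
  ext ⟨x, y⟩
  simp only [Set.image_neg_eq_neg, Set.mem_neg, Set.mem_ofPred_eq,
    Prod.neg_mk, ne_eq, neg_inj]
  refine and_congr_right fun _ => ⟨fun h => ?_, fun h => ?_⟩
  · simpa using h.turn
  · simpa [turn_turn] using h.turn

lemma sum_numDownJumps [NeZero L] (σ : Config L) :
    ∑ τ ∈ Finset.univ.erase σ, numDownJumps L σ τ =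
      ∑ τ ∈ Finset.univ.erase (turn σ), numUpJumps L (turn σ) τ := by
  refine Finset.sum_equiv turn (fun τ => ?_) (fun τ _ => numDownJumps_eq σ τ)
  simp

lemma upOpen_turn {σ : Config L} {z : Pos L} :
    UpOpen (turn σ) (-z - u L) ↔ DownOpen σ z := by
  have e1 : -(-z - u L + u L + dvec L 2) = z - (0, 1) := by ext <;> simp [dvec, u, neg_add_eq_sub]
  have e2 : -(-z - u L - (0, 1) + dvec L 1) = z := by ext <;> simp [dvec, u]
  simp only [UpOpen, DownOpen, mem_turn, halfTurn_apply, e1, e2]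
  exact and_comm

/-- From every perfect matching there are as many up-jumps as down-jumps. -/
theorem IsPM.sum_numUpJumps_eq_sum_numDownJumps [NeZero L] (hL : 3 ≤ L) {σ : Config L}
    (hσ : IsPM L σ) :
    ∑ τ ∈ Finset.univ.erase σ, numUpJumps L σ τ =
      ∑ τ ∈ Finset.univ.erase σ, numDownJumps L σ τ := by
  classical
  rw [sum_numDownJumps]
  by_cases hb : ∃ b : Pos L, (b, (0 : Fin 3)) ∈ σ
  · obtain ⟨b, hb⟩ := hb
    rw [hσ.sum_numUpJumps_eq_card_upOpen hL hb,
      hσ.turn.sum_numUpJumps_eq_card_upOpen hL (b := -b) (by simpa [bead_mem_turn] using hb),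
      hσ.card_upOpen_eq]
    refine Finset.card_bij (fun z _ => -z - u L) ?_ ?_ ?_
    · intro z hz
      simpa [upOpen_turn] using hz
    · intro z _ z' _ h
      simpa using h
    · intro z hz
      refine ⟨-z - u L, ?_, by simp⟩
      rw [Finset.mem_filter] at hz ⊢
      rw [← upOpen_turn]
      simpa using hz
  · push Not at hb
    rw [sum_numUpJumps_eq_zero hb, sum_numUpJumps_eq_zero (fun b => by
      rw [bead_mem_turn]; exact hb _)]

/-! ### Reversing jumps -/

lemma IsPM.disjoint_highTriple {σ : Config L} (h : IsPM L σ) {x : Pos L} (hc : CanUp L σ x) :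
    Disjoint σ (highTriple L x) := by
  obtain ⟨h0, h2, h1⟩ := canUp_iff.1 hc
  rw [Finset.disjoint_right]
  intro e he hmem
  simp only [highTriple, Finset.mem_insert, Finset.mem_singleton] at he
  rcases he with rfl | rfl | rfl
  · exact absurd (h.dir_unique h0 hmem) (by decide)
  · exact absurd (h.dir_unique h2 hmem) (by decide)
  · exact absurd (h.dir_unique h1 hmem) (by decide)

lemma IsPM.downMove_upMove {σ : Config L} (h : IsPM L σ) {x : Pos L} (hc : CanUp L σ x) :
    downMove L (upMove L σ x) (x + u L) = σ := by
  have hd := Finset.disjoint_left.1 (h.disjoint_highTriple hc)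
  ext e
  have hl : e ∈ lowTriple L x → e ∈ σ := fun he => hc he
  have hd' := @hd e
  simp only [downMove, upMove, add_sub_cancel_right, Finset.mem_union, Finset.mem_sdiff]
  tauto

lemma canDown_upMove (σ : Config L) (x : Pos L) :
    CanDown L (upMove L σ x) (x + u L) := by
  rw [CanDown, add_sub_cancel_right]
  exact Finset.subset_union_right

lemma DownPath.trans {σ τ υ : Config L} {x y z : Pos L} (h : DownPath L σ x y τ)
    (h' : DownPath L τ y z υ) : DownPath L σ x z υ := by
  induction h with
  | refl => exact h'
  | step hc _ ih => exact .step hc (ih h')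

/-- Up-paths inside a class of perfect matchings closed under elementary up-moves stay in this
class and can be reversed. -/
lemma UpPath.reverse {C : Config L → Prop} (hpm : ∀ σ, C σ → IsPM L σ)
    (hC : ∀ σ x, C σ → CanUp L σ x → C (upMove L σ x)) {σ τ : Config L} {x y : Pos L}
    (h : UpPath L σ x y τ) (hσ : C σ) : C τ ∧ DownPath L τ y x σ := by
  induction h with
  | refl => exact ⟨hσ, .refl _ _⟩
  | @step σ x y τ hc _ ih =>
    obtain ⟨h1, h2⟩ := ih (hC σ x hσ hc)
    refine ⟨h1, h2.trans (.step (canDown_upMove σ x) ?_)⟩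
    rw [(hpm σ hσ).downMove_upMove hc, add_sub_cancel_right]
    exact .refl _ _

lemma DownPath.reverse {C : Config L → Prop} (hpm : ∀ σ, C σ → IsPM L σ)
    (hC : ∀ σ x, C σ → CanDown L σ x → C (downMove L σ x)) {σ τ : Config L} {x y : Pos L}
    (h : DownPath L σ x y τ) (hσ : C σ) : C τ ∧ UpPath L τ y x σ := by
  have key := h.turn.reverse (C := fun σ => C (HexDimer.turn σ))
    (fun σ hσ => by simpa [turn_turn] using (hpm _ hσ).turn)
    (fun σ x hσ hc => by
      have := hC (HexDimer.turn σ) (-x) hσ (canUp_turn.1 (by rwa [turn_turn, neg_neg]))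
      rwa [← turn_turn (downMove L _ _), ← upMove_turn, turn_turn, neg_neg] at this)
    (by simpa [turn_turn] using hσ)
  refine ⟨by simpa [turn_turn] using key.1, ?_⟩
  simpa [turn_turn] using key.2.turn

lemma numJumps_swap (σ τ : Config L) (h : ∀ x y, UpPath L σ x y τ ↔ DownPath L τ y x σ) :
    numUpJumps L σ τ = numDownJumps L τ σ := by
  rw [numDownJumps, ← Set.ncard_image_of_injective _ (Prod.swap_injective), numUpJumps]
  congr 1
  ext ⟨x, y⟩
  simp [Set.image_swap_eq_preimage_swap, h, eq_comm]

variable (L)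

/-- Let `L ≥ 3`, `p, q ≥ 0`, and let `N` be a nonempty set of perfect
matchings of the hexagonal torus `T_L` closed under single-bead up-jumps and down-jumps.
Then the uniform probability measure `π` on `N` is stationary for the generator `𝓛`:
for every `σ ∈ N`, `∑_{σ' ∈ N} π(σ')·𝓛(σ',σ) = 0`. -/
theorem uniform_stationary [NeZero L] (hL : 3 ≤ L) (p q : ℝ) (hp : 0 ≤ p) (hq : 0 ≤ q)
    (N : Finset (Config L)) (hNne : N.Nonempty) (hNpm : ∀ σ ∈ N, IsPM L σ)
    (hNup : ∀ σ ∈ N, ∀ τ : Config L, IsUpJump L σ τ → τ ∈ N)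
    (hNdown : ∀ σ ∈ N, ∀ τ : Config L, IsDownJump L σ τ → τ ∈ N)
    (σ : Config L) (hσ : σ ∈ N) :
    ∑ σ' ∈ N, ((N.card : ℝ))⁻¹ * Gen L p q σ' σ = 0 := by
  classical
  have hu : u L ≠ 0 := by
    simpa using nsmul_u_ne_zero (L := L) one_pos (by omega)
  have hup : ∀ σ x, σ ∈ N → CanUp L σ x → upMove L σ x ∈ N := fun σ x h hc =>
    hNup σ h _ ⟨x, x + u L, by simpa using hu, .step hc (.refl _ _)⟩
  have hdown : ∀ σ x, σ ∈ N → CanDown L σ x → downMove L σ x ∈ N := fun σ x h hc =>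
    hNdown σ h _ ⟨x, x - u L, by simpa using hu, .step hc (.refl _ _)⟩
  have hswap : ∀ τ ∈ N, ∀ τ' ∈ N, numUpJumps L τ τ' = numDownJumps L τ' τ := fun τ hτ τ' hτ' =>
    numJumps_swap τ τ' fun x y =>
      ⟨fun h => (h.reverse (C := (· ∈ N)) hNpm hup hτ).2,
        fun h => (h.reverse (C := (· ∈ N)) hNpm hdown hτ').2⟩
  have hsubset : N.erase σ ⊆ Finset.univ.erase σ :=
    Finset.erase_subset_erase _ (Finset.subset_univ N)
  have hrestrict : ∀ f : Config L → ℕ, (∀ τ, τ ∉ N → f τ = 0) →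
      ∑ τ ∈ Finset.univ.erase σ, f τ = ∑ τ ∈ N.erase σ, f τ := fun f hf =>
    (Finset.sum_subset hsubset fun τ h1 h2 => hf τ fun h => h2 <|
      Finset.mem_erase.2 ⟨Finset.ne_of_mem_erase h1, h⟩).symm
  have hup0 : ∀ τ, τ ∉ N → numUpJumps L σ τ = 0 := by
    intro τ hτ
    rw [numUpJumps, Set.ncard_eq_zero, Set.eq_empty_iff_forall_notMem]
    rintro ⟨x, y⟩ ⟨hne, h⟩
    exact hτ (hNup σ hσ τ ⟨x, y, hne, h⟩)
  have hdown0 : ∀ τ, τ ∉ N → numDownJumps L σ τ = 0 := by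
    intro τ hτ
    rw [numDownJumps, Set.ncard_eq_zero, Set.eq_empty_iff_forall_notMem]
    rintro ⟨x, y⟩ ⟨hne, h⟩
    exact hτ (hNdown σ hσ τ ⟨x, y, hne, h⟩)
  have hbal := (hNpm σ hσ).sum_numUpJumps_eq_sum_numDownJumps hL
  have hin : ∑ τ ∈ N.erase σ, Gen L p q τ σ =
      p * ((∑ τ ∈ Finset.univ.erase σ, numDownJumps L σ τ : ℕ) : ℝ)
        + q * ((∑ τ ∈ Finset.univ.erase σ, numUpJumps L σ τ : ℕ) : ℝ) := by
    rw [hrestrict _ hup0, hrestrict _ hdown0, Nat.cast_sum, Nat.cast_sum, Finset.mul_sum,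
      Finset.mul_sum, ← Finset.sum_add_distrib]
    refine Finset.sum_congr rfl fun τ hτ => ?_
    obtain ⟨hne, hmem⟩ := Finset.mem_erase.1 hτ
    rw [Gen, if_neg hne.symm, hswap τ hmem σ hσ, hswap σ hσ τ hmem]
  have hout : Gen L p q σ σ =
      -(p * ((∑ τ ∈ Finset.univ.erase σ, numUpJumps L σ τ : ℕ) : ℝ)
        + q * ((∑ τ ∈ Finset.univ.erase σ, numDownJumps L σ τ : ℕ) : ℝ)) := by
    rw [Gen, if_pos rfl, Finset.sum_add_distrib, ← Finset.mul_sum, ← Finset.mul_sum,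
      Nat.cast_sum, Nat.cast_sum]
  rw [← Finset.mul_sum, ← Finset.add_sum_erase N _ hσ, hin, hout, hbal]
  ring

end HexDimer
end

section
/- Let L ≥ 3 and let σ be a perfect matching of the square-lattice torus G_L. Suppose two opposite edges of a square face F carry dimers of σ and let σ' be the matching obtained from σ by the elementary move at F. Then the sum over all beads b of σ' of (|I⁺_b(σ')| − |I⁻_b(σ')|) equals the sum over all beads b of σ of (|I⁺_b(σ)| − |I⁻_b(σ)|). -/
/-!
Dimer coverings (perfect matchings) of the square-lattice torus
`G_L = ℤ² / ⟨L·(1,1), L·(−1,1)⟩`, beads (dimers on transversal edges of the zig-zag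
columns), elementary moves and the sets `I⁺_b`, `I⁻_b`.

We identify `ℤ² / ⟨L·(1,1), L·(−1,1)⟩` with `ZMod L × ZMod (2L)` via the group
isomorphism induced by `(a, b) ↦ (b mod L, (a − b) mod 2L)`; under this identification
the unit step `(1,0)` of `ℤ²` becomes `E1 = (0,1)` and the unit step `(0,1)` becomes
`E2 = (1,−1)`.  In particular the second coordinate of a vertex is `a − b (mod 2L)`,
whose parity decides the column structure.
-/

namespace SqDimer

variable (L : ℕ)

/-- Vertices of the square-lattice torus `G_L`. -/
abbrev V := ZMod L × ZMod (2 * L)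

/-- Image of the unit step `(1,0)` of `ℤ²`. -/
def E1 : V L := (0, 1)

/-- Image of the unit step `(0,1)` of `ℤ²`. -/
def E2 : V L := (1, -1)

/-- An edge of `G_L` is encoded by its lower/left endpoint `v` and a direction:
`false` = the horizontal edge from `v` to `v + E1` (i.e. `(a,b)–(a+1,b)` in `ℤ²`),
`true` = the vertical edge from `v` to `v + E2` (i.e. `(a,b)–(a,b+1)`). -/
abbrev SqEdge := V L × Bool

/-- The second endpoint of an edge. -/
def endpt (e : SqEdge L) : V L := e.1 + (if e.2 then E2 L else E1 L)

/-- A configuration: a (finite) set of edges. -/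
abbrev Config := Finset (SqEdge L)

/-- `σ` is a perfect matching of `G_L`: every vertex belongs to exactly one edge of `σ`. -/
def IsPM (σ : Config L) : Prop :=
  ∀ w : V L, ∃! e : SqEdge L, e ∈ σ ∧ (e.1 = w ∨ endpt L e = w)

/-- `e` is a transversal edge (a possible bead position): a horizontal edge `(v,false)`
with `a − b` even, shared by two consecutive faces of the column `ℓ ≡ (a−b)/2`, or a
vertical edge `(v,true)` with `a − b` odd. -/
def IsBeadPos (e : SqEdge L) : Prop :=
  if e.2 then Odd e.1.2.val else Even e.1.2.val

instance : DecidablePred (IsBeadPos L) := fun e => by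
  unfold IsBeadPos; infer_instance

/-- The beads of `σ`: dimers of `σ` sitting on transversal edges. -/
def beads (σ : Config L) : Finset (SqEdge L) := σ.filter (IsBeadPos L)

/-- One elementary up-move: the bead at the transversal edge `e` of `σ` moves one step up
along its column, through the face of its column lying just above it, by rotating the two
parallel dimers of that face onto the two opposite edges; `σ'` is the new configuration
and `e'` the new bead position.

For a horizontal bead `(v,false)` (with `a − b` even) the relevant face is `F(v)`, the
move requires the dimer `(v+E2, false)` (the top edge of `F(v)`), and produces the
dimers `(v,true)`, `(v+E1,true)`, the bead becoming `(v+E1, true)`.  For a vertical bead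
`(v,true)` (with `a − b` odd) the move requires the dimer `(v+E1, true)` and produces
`(v,false)`, `(v+E2,false)`, the bead becoming `(v+E2, false)`. -/
def UpStep (σ : Config L) (e : SqEdge L) (σ' : Config L) (e' : SqEdge L) : Prop :=
  (∃ v : V L, Even v.2.val ∧ e = (v, false) ∧ (v, false) ∈ σ ∧ (v + E2 L, false) ∈ σ ∧
      e' = (v + E1 L, true) ∧
      σ' = (σ \ {(v, false), (v + E2 L, false)}) ∪ {(v, true), (v + E1 L, true)}) ∨
  (∃ v : V L, Odd v.2.val ∧ e = (v, true) ∧ (v, true) ∈ σ ∧ (v + E1 L, true) ∈ σ ∧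
      e' = (v + E2 L, false) ∧
      σ' = (σ \ {(v, true), (v + E1 L, true)}) ∪ {(v, false), (v + E2 L, false)})

/-- One elementary down-move: the inverse of an elementary up-move. -/
def DownStep (σ : Config L) (e : SqEdge L) (σ' : Config L) (e' : SqEdge L) : Prop :=
  UpStep L σ' e' σ e

/-- `UpPath σ e f σ'`: a concatenation of elementary up-moves, each moving the same bead
and no other bead, brings the bead from the transversal edge `e` to the transversal edge
`f`, the configuration becoming `σ'`. -/
inductive UpPath : Config L → SqEdge L → SqEdge L → Config L → Prop
  | refl (σ : Config L) (e : SqEdge L) : UpPath σ e e σ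
  | step {σ : Config L} {e : SqEdge L} {σ₁ : Config L} {e₁ : SqEdge L} {f : SqEdge L}
      {σ' : Config L} :
      UpStep L σ e σ₁ e₁ → UpPath σ₁ e₁ f σ' → UpPath σ e f σ'

/-- `DownPath σ e f σ'`: a concatenation of elementary down-moves of a single bead. -/
inductive DownPath : Config L → SqEdge L → SqEdge L → Config L → Prop
  | refl (σ : Config L) (e : SqEdge L) : DownPath σ e e σ
  | step {σ : Config L} {e : SqEdge L} {σ₁ : Config L} {e₁ : SqEdge L} {f : SqEdge L}
      {σ' : Config L} :
      DownStep L σ e σ₁ e₁ → DownPath σ₁ e₁ f σ' → DownPath σ e f σ'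

/-- `I⁺_b(σ)`: the set of transversal-edge positions available above the bead at `e`. -/
def Iplus (σ : Config L) (e : SqEdge L) : Set (SqEdge L) :=
  {f | f ≠ e ∧ ∃ σ' : Config L, UpPath L σ e f σ'}

/-- `I⁻_b(σ)`: the set of transversal-edge positions available below the bead at `e`. -/
def Iminus (σ : Config L) (e : SqEdge L) : Set (SqEdge L) :=
  {f | f ≠ e ∧ ∃ σ' : Config L, DownPath L σ e f σ'}

/-- The elementary move at the face `F(v)`: two opposite edges of `F(v)` carry dimers of
`σ` and they are rotated onto the other two opposite edges of `F(v)`.  The edges of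
`F(v)` are bottom `(v,false)`, top `(v+E2,false)`, left `(v,true)`, right `(v+E1,true)`. -/
def ElemMoveAt (σ σ' : Config L) (v : V L) : Prop :=
  ((v, false) ∈ σ ∧ (v + E2 L, false) ∈ σ ∧
      σ' = (σ \ {(v, false), (v + E2 L, false)}) ∪ {(v, true), (v + E1 L, true)}) ∨
  ((v, true) ∈ σ ∧ (v + E1 L, true) ∈ σ ∧
      σ' = (σ \ {(v, true), (v + E1 L, true)}) ∪ {(v, false), (v + E2 L, false)})

/-- The edge data along the columns: `next` is the successor of a face in its column, `T` the
lower transversal edge of a face, `S` (resp. `S'`) the non-transversal edge that has to carry a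
dimer for a bead to cross the face upwards (resp. downwards). -/
structure BeadSystem (F E : Type*) where
  next : Equiv.Perm F
  T : F → E
  S : F → E
  S' : F → E

namespace BeadSystem

variable {F E : Type*} (c : BeadSystem F E) {σ : Finset E}

/-- The same columns, traversed downwards. -/
def dual : BeadSystem F E where
  next := c.next.symm
  T := c.T
  S x := c.S' (c.next.symm x)
  S' x := c.S (c.next.symm x)

/-- The single-column constraints satisfied by a perfect matching. -/
structure Admissible (σ : Finset E) : Prop where
  covered : ∀ x, c.T (c.next x) ∈ σ ∨ c.T (c.next (c.next x)) ∈ σ ∨ c.S x ∈ σ ∨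
    c.S' (c.next (c.next x)) ∈ σ
  not_T_T : ∀ x, ¬ (c.T x ∈ σ ∧ c.T (c.next x) ∈ σ)
  not_T_S : ∀ x, ¬ (c.T (c.next x) ∈ σ ∧ c.S x ∈ σ)
  not_TT_S : ∀ x, ¬ (c.T (c.next (c.next x)) ∈ σ ∧ c.S x ∈ σ)
  not_T_S' : ∀ x, ¬ (c.T x ∈ σ ∧ c.S' x ∈ σ)
  not_T_S'' : ∀ x, ¬ (c.T x ∈ σ ∧ c.S' (c.next x) ∈ σ)
  not_S_S' : ∀ x, ¬ (c.S x ∈ σ ∧ c.S' (c.next (c.next x)) ∈ σ)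
  not_S_S'_self : ∀ x, ¬ (c.S x ∈ σ ∧ c.S' x ∈ σ)

variable {c}

theorem Admissible.dual (h : c.Admissible σ) : c.dual.Admissible σ where
  covered x := by
    have := h.covered (c.next.symm (c.next.symm (c.next.symm x)))
    simp only [Equiv.apply_symm_apply] at this
    simp only [BeadSystem.dual]
    tauto
  not_T_T x := by
    have := h.not_T_T (c.next.symm x)
    simp only [Equiv.apply_symm_apply] at this
    simp only [BeadSystem.dual]
    tauto
  not_T_S x := by simpa [BeadSystem.dual] using h.not_T_S' (c.next.symm x)
  not_TT_S x := by simpa [BeadSystem.dual] using h.not_T_S'' (c.next.symm (c.next.symm x))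
  not_T_S' x := by simpa [BeadSystem.dual] using h.not_T_S (c.next.symm x)
  not_T_S'' x := by simpa [BeadSystem.dual] using h.not_TT_S (c.next.symm (c.next.symm x))
  not_S_S' x := by
    have := h.not_S_S' (c.next.symm (c.next.symm (c.next.symm x)))
    simp only [Equiv.apply_symm_apply] at this
    simp only [BeadSystem.dual]
    tauto
  not_S_S'_self x := by
    have := h.not_S_S'_self (c.next.symm x)
    simp only [BeadSystem.dual]
    tauto

variable (c) in
/-- `Reach σ v w`: a bead on the lower edge of `v` can cross all faces from `v` up to the
predecessor of `w`. -/
def Reach (σ : Finset E) : F → F → Prop :=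
  Relation.ReflTransGen fun x y => y = c.next x ∧ c.S x ∈ σ

variable (c) in
/-- Some bead of `σ` reaches the lower edge of `x`. -/
def Reached (σ : Finset E) (x : F) : Prop := ∃ v, c.T v ∈ σ ∧ c.Reach σ v x

theorem Reach.next {v x : F} (h : c.Reach σ v x) (hx : c.S x ∈ σ) : c.Reach σ v (c.next x) :=
  Relation.ReflTransGen.tail h ⟨rfl, hx⟩

theorem Reach.eq_or_exists {v w : F} (h : c.Reach σ v w) :
    v = w ∨ ∃ x, c.Reach σ v x ∧ w = c.next x ∧ c.S x ∈ σ := by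
  rcases Relation.ReflTransGen.cases_tail h with h | ⟨x, hx, hw⟩
  · exact .inl h.symm
  · exact .inr ⟨x, hx, hw⟩

theorem Reach.source_unique (hσ : c.Admissible σ) {v v' w : F} (hv : c.T v ∈ σ)
    (hv' : c.T v' ∈ σ) (h : c.Reach σ v w) (h' : c.Reach σ v' w) : v = v' := by
  induction h with
  | refl =>
    rcases h'.eq_or_exists with h' | ⟨x, -, rfl, hx⟩
    · exact h'.symm
    · exact (hσ.not_T_S x ⟨hv, hx⟩).elim
  | tail h hxy ih =>
    obtain ⟨rfl, hx⟩ := hxy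
    rcases h'.eq_or_exists with rfl | ⟨y, hy, hxy, -⟩
    · exact (hσ.not_T_S _ ⟨hv', hx⟩).elim
    · rw [c.next.injective hxy] at ih
      exact ih hy

theorem Reached.of_T_mem {x : F} (h : c.T x ∈ σ) : c.Reached σ x := ⟨x, h, .refl⟩

theorem Reached.next {x : F} (h : c.Reached σ x) (hx : c.S x ∈ σ) : c.Reached σ (c.next x) := by
  obtain ⟨v, hv, h⟩ := h
  exact ⟨v, hv, h.next hx⟩

/-- Each face that is passable upwards but reached by no bead from below is followed by a face
that is passable downwards but reached by no bead from above. -/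
theorem not_reached_dual [Finite F] (hσ : c.Admissible σ)
    (hc : ∀ v, ∃ w, c.next.SameCycle v w ∧ c.T w ∈ σ) {x : F} (hx : c.S x ∈ σ)
    (hP : ¬ c.Reached σ x) :
    c.S' (c.next x) ∈ σ ∧ ¬ c.dual.Reached σ (c.next (c.next x)) := by
  constructor
  · by_contra hS'
    have step (y : F) (hy : ¬ c.Reached σ (c.next y)) (hP : ¬ c.Reached σ (c.next (c.next y)))
        (hS' : c.S' (c.next (c.next y)) ∉ σ) : c.S y ∈ σ := by
      rcases hσ.covered y with h | h | h | h
      · exact (hy (.of_T_mem h)).elim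
      · exact (hP (.of_T_mem h)).elim
      · exact h
      · exact (hS' h).elim
    have hx' : c.S (c.next.symm x) ∈ σ := by
      have := hσ.covered (c.next.symm x)
      simp only [Equiv.apply_symm_apply] at this
      rcases this with h | h | h | h
      · exact (hP (.of_T_mem h)).elim
      · exact (hσ.not_T_S x ⟨h, hx⟩).elim
      · exact h
      · exact (hS' h).elim
    have key (k : ℕ) : c.S ((c.next.symm ^ k) x) ∈ σ ∧ c.S (c.next.symm ((c.next.symm ^ k) x)) ∈ σ ∧
        ¬ c.Reached σ ((c.next.symm ^ k) x) := by
      induction k with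
      | zero => exact ⟨hx, hx', hP⟩
      | succ k ih =>
        rw [pow_succ', Equiv.Perm.mul_apply]
        generalize (c.next.symm ^ k) x = z at ih
        obtain ⟨h₁, h₂, h₃⟩ := ih
        have h₄ : ¬ c.Reached σ (c.next.symm z) := fun h => h₃ <| by simpa using h.next h₂
        refine ⟨h₂, step _ ?_ ?_ ?_, h₄⟩ <;> simp only [Equiv.apply_symm_apply]
        · exact h₄
        · exact h₃
        · exact fun h => hσ.not_S_S'_self z ⟨h₁, h⟩
    obtain ⟨w, hw, hTw⟩ := hc x
    obtain ⟨k, -, -, rfl⟩ := (Equiv.Perm.sameCycle_inv.2 hw).exists_pow_eq'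
    exact (key k).2.2 (.of_T_mem hTw)
  · rintro ⟨v, hv, h⟩
    rcases h.eq_or_exists with rfl | ⟨y, -, hy, hS⟩
    · exact hσ.not_TT_S x ⟨hv, hx⟩
    · have : y = c.next (c.next (c.next x)) := by
        rw [hy]; simp [BeadSystem.dual]
      subst this
      exact hσ.not_S_S' x ⟨hx, by simpa [BeadSystem.dual] using hS⟩

theorem not_reached_iff [Finite F] (hσ : c.Admissible σ)
    (hc : ∀ v, ∃ w, c.next.SameCycle v w ∧ c.T w ∈ σ) (x : F) :
    (c.S x ∈ σ ∧ ¬ c.Reached σ x) ↔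
      (c.dual.S (c.next (c.next x)) ∈ σ ∧ ¬ c.dual.Reached σ (c.next (c.next x))) := by
  constructor
  · rintro ⟨h, h'⟩
    simpa [BeadSystem.dual] using not_reached_dual hσ hc h h'
  · rintro ⟨h, h'⟩
    have hc' : ∀ v, ∃ w, c.dual.next.SameCycle v w ∧ c.dual.T w ∈ σ := fun v => by
      obtain ⟨w, hw, hT⟩ := hc v
      exact ⟨w, Equiv.Perm.sameCycle_inv.2 hw, hT⟩
    simpa [BeadSystem.dual] using not_reached_dual hσ.dual hc' h h'

open Classical in
/-- If equally many faces are passable upwards and downwards, then equally many are crossed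
by a bead upwards and downwards. -/
theorem card_crossed_eq_dual [Fintype F] (hσ : c.Admissible σ)
    (hc : ∀ v, ∃ w, c.next.SameCycle v w ∧ c.T w ∈ σ)
    (hcard : ({x | c.S x ∈ σ} : Finset F).card = ({x | c.dual.S x ∈ σ} : Finset F).card) :
    ({x | c.S x ∈ σ ∧ c.Reached σ x} : Finset F).card =
      ({x | c.dual.S x ∈ σ ∧ c.dual.Reached σ x} : Finset F).card := by
  have hunreached : ({x | c.S x ∈ σ ∧ ¬ c.Reached σ x} : Finset F).card =
      ({x | c.dual.S x ∈ σ ∧ ¬ c.dual.Reached σ x} : Finset F).card :=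
    Finset.card_equiv (c.next.trans c.next) fun x => by
      simpa using not_reached_iff hσ hc x
  have h₁ := Finset.card_filter_add_card_filter_not (s := ({x | c.S x ∈ σ} : Finset F))
    (c.Reached σ)
  have h₂ := Finset.card_filter_add_card_filter_not
    (s := ({x | c.dual.S x ∈ σ} : Finset F)) (c.dual.Reached σ)
  simp only [Finset.filter_filter] at h₁ h₂
  omega

open Classical in
theorem sum_ncard_reach [Fintype F] (hσ : c.Admissible σ) :
    ∑ v with c.T v ∈ σ, {w | w ≠ v ∧ c.Reach σ v w}.ncard =
      ({x | c.S x ∈ σ ∧ c.Reached σ x} : Finset F).card := by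
  have : ({x | c.S x ∈ σ ∧ c.Reached σ x} : Finset F) =
      Finset.biUnion {v | c.T v ∈ σ}
        fun v => {x | c.S x ∈ σ ∧ c.Reach σ v x} := by
    ext x
    simp only [Finset.mem_filter, Finset.mem_univ, true_and, Finset.mem_biUnion]
    simp only [Reached]
    tauto
  rw [this, Finset.card_biUnion]
  · refine Finset.sum_congr rfl fun v hv => ?_
    have hv : c.T v ∈ σ := by simpa using hv
    rw [← Set.ncard_coe_finset]
    refine (Set.ncard_congr (fun x _ => c.next x) ?_ (fun x y _ _ h => c.next.injective h) ?_).symm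
    · intro x hx
      obtain ⟨hS, hR⟩ : c.S x ∈ σ ∧ c.Reach σ v x := by simpa using hx
      refine ⟨?_, hR.next hS⟩
      rintro rfl
      exact hσ.not_T_S x ⟨hv, hS⟩
    · rintro w ⟨hne, hR⟩
      rcases hR.eq_or_exists with rfl | ⟨x, hx, rfl, hS⟩
      · exact (hne rfl).elim
      · exact ⟨x, by simpa using ⟨hS, hx⟩, rfl⟩
  · intro v hv v' hv' hne
    refine Finset.disjoint_left.2 fun x hx hx' => hne ?_
    simp only [Finset.mem_filter, Finset.mem_univ, true_and, Finset.coe_filter,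
      Set.mem_ofPred_eq] at hv hv' hx hx'
    exact Reach.source_unique hσ hv hv' hx.2 hx'.2

variable (c) in
/-- `Step` is a single move of a bead of an admissible configuration through a face, as seen from
`c`; `Good` is an invariant of such moves that implies admissibility. -/
structure IsStep (Good : Finset E → Prop) (Step : Finset E × E → Finset E × E → Prop) : Prop where
  admissible : ∀ σ, Good σ → c.Admissible σ
  T_injective : Function.Injective c.T
  S_injective : Function.Injective c.S
  S_ne_T : ∀ x y, c.S x ≠ c.T y
  S_ne_S' : ∀ x y, c.next.SameCycle x y → c.S x ≠ c.S' y
  of_step : ∀ {σ e σ₁ e₁}, Step (σ, e) (σ₁, e₁) → ∃ v, e = c.T v ∧ c.S v ∈ σ ∧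
    e₁ = c.T (c.next v) ∧ ∀ f ∈ σ₁, f ∈ σ ∨ f = c.S' v ∨ f = c.T (c.next v)
  exists_step : ∀ {σ v}, Good σ → c.T v ∈ σ → c.S v ∈ σ →
    ∃ σ₁, Step (σ, c.T v) (σ₁, c.T (c.next v)) ∧ Good σ₁ ∧ c.T (c.next v) ∈ σ₁ ∧
      ∀ f ∈ σ, f ≠ c.T v → f ≠ c.S v → f ∈ σ₁

variable {Good : Finset E → Prop} {Step : Finset E × E → Finset E × E → Prop}

theorem Reach.sameCycle {v w : F} (h : c.Reach σ v w) : c.next.SameCycle v w := by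
  induction h with
  | refl => exact .refl _ _
  | tail _ h ih => rw [h.1]; exact Equiv.Perm.sameCycle_apply_right.2 ih

theorem IsStep.reach_of_path (hs : c.IsStep Good Step) {p q : Finset E × E}
    (h : Relation.ReflTransGen Step p q) {v : F} (hv : p.2 = c.T v) :
    ∃ w, q.2 = c.T w ∧ c.Reach p.1 v w := by
  induction h using Relation.ReflTransGen.head_induction_on generalizing v with
  | refl => exact ⟨v, hv, .refl⟩
  | @head p p₁ hstep _ ih =>
    obtain ⟨v', he, hS, he₁, hsub⟩ := hs.of_step (e := p.2) (e₁ := p₁.2) hstep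
    obtain rfl : v = v' := hs.T_injective (hv.symm.trans he)
    obtain ⟨w, hw, hr⟩ := ih he₁
    refine ⟨w, hw, Relation.ReflTransGen.head ⟨rfl, hS⟩ ?_⟩
    clear hw
    induction hr with
    | refl => exact .refl
    | @tail x y hx hxy ih =>
      obtain ⟨rfl, hSx⟩ := hxy
      refine Reach.next ih ?_
      rcases hsub _ hSx with h | h | h
      · exact h
      · have hvx : c.next.SameCycle v x := Equiv.Perm.sameCycle_apply_left.1 (Reach.sameCycle hx)
        exact (hs.S_ne_S' _ _ hvx.symm h).elim
      · exact (hs.S_ne_T _ _ h).elim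

theorem Reach.exists_iterate {v w : F} (h : c.Reach σ v w) :
    ∃ k, w = c.next^[k] v ∧ ∀ i < k, c.S (c.next^[i] v) ∈ σ := by
  induction h with
  | refl => exact ⟨0, rfl, by simp⟩
  | tail _ h ih =>
    obtain ⟨k, rfl, hk⟩ := ih
    refine ⟨k + 1, by rw [h.1, Function.iterate_succ_apply'], fun i hi => ?_⟩
    rcases Nat.lt_succ_iff_lt_or_eq.1 hi with hi | rfl
    · exact hk i hi
    · exact h.2

theorem IsStep.path_of_iterate (hs : c.IsStep Good Step) (k : ℕ) {v : F} (hσ : Good σ)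
    (hv : c.T v ∈ σ) (hk : ∀ i < k, c.S (c.next^[i] v) ∈ σ) :
    ∃ σ', Relation.ReflTransGen Step (σ, c.T v) (σ', c.T (c.next^[k] v)) := by
  induction k generalizing σ v with
  | zero => exact ⟨σ, .refl⟩
  | succ k ih =>
    obtain ⟨σ₁, hstep, hσ₁, hT, hsub⟩ := hs.exists_step hσ hv (hk 0 k.succ_pos)
    obtain ⟨σ', h⟩ := ih hσ₁ hT fun i hi => by
      refine hsub _ (hk (i + 1) (by omega)) (hs.S_ne_T _ _) fun h => ?_
      have h := hs.S_injective h
      rw [← Function.iterate_succ_apply, Function.iterate_succ_apply'] at h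
      refine (hs.admissible σ hσ).not_T_S (c.next^[i] v) ⟨?_, hk i (by omega)⟩
      rwa [h]
    exact ⟨σ', .head hstep h⟩

theorem IsStep.setOf_path (hs : c.IsStep Good Step) (hσ : Good σ) {v : F} (hv : c.T v ∈ σ) :
    {f | f ≠ c.T v ∧ ∃ σ', Relation.ReflTransGen Step (σ, c.T v) (σ', f)} =
      c.T '' {w | w ≠ v ∧ c.Reach σ v w} := by
  ext f
  constructor
  · rintro ⟨hne, σ', h⟩
    obtain ⟨w, rfl, hw⟩ := hs.reach_of_path h rfl
    exact ⟨w, ⟨fun h => hne (h ▸ rfl), hw⟩, rfl⟩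
  · rintro ⟨w, ⟨hne, hw⟩, rfl⟩
    obtain ⟨k, rfl, hk⟩ := hw.exists_iterate
    exact ⟨fun h => hne (hs.T_injective h), hs.path_of_iterate k hσ hv hk⟩

open Classical in
theorem IsStep.sum_ncard_path [Fintype F] (hs : c.IsStep Good Step) (hσ : Good σ) :
    ∑ e ∈ σ with e ∈ Set.range c.T,
      {f | f ≠ e ∧ ∃ σ', Relation.ReflTransGen Step (σ, e) (σ', f)}.ncard =
      ({x | c.S x ∈ σ ∧ c.Reached σ x} : Finset F).card := by
  rw [← sum_ncard_reach (hs.admissible σ hσ)]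
  refine (Finset.sum_nbij c.T ?_ hs.T_injective.injOn ?_ ?_).symm
  · intro v hv
    simpa using hv
  · rintro e he
    obtain ⟨h, v, rfl⟩ : e ∈ σ ∧ e ∈ Set.range c.T := by simpa using he
    exact ⟨v, by simpa using h, rfl⟩
  · intro v hv
    rw [hs.setOf_path hσ (by simpa using hv), Set.ncard_image_of_injective _ hs.T_injective]

end BeadSystem

section Dimers

variable {L}

theorem E1_ne_zero (hL : 2 ≤ L) : E1 L ≠ 0 := by
  have : Fact (1 < 2 * L) := ⟨by omega⟩
  simp [E1, Prod.ext_iff]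

theorem E2_ne_zero (hL : 2 ≤ L) : E2 L ≠ 0 := by
  have : Fact (1 < 2 * L) := ⟨by omega⟩
  simp [E2, Prod.ext_iff]

theorem two_ne_zero_zmod (hL : 2 ≤ L) : (2 : ZMod (2 * L)) ≠ 0 := by
  intro h
  have h' : ((2 : ℕ) : ZMod (2 * L)) = 0 := by exact_mod_cast h
  rw [ZMod.natCast_eq_zero_iff] at h'
  have := Nat.le_of_dvd (by norm_num) h'
  omega

/-- The number of dimers of `σ` on the edges at `w`. -/
def deg (σ : Config L) (w : V L) : ℤ :=
  (if (w, false) ∈ σ then 1 else 0) + (if (w - E1 L, false) ∈ σ then 1 else 0) +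
    (if (w, true) ∈ σ then 1 else 0) + (if (w - E2 L, true) ∈ σ then 1 else 0)

theorem isPM_iff_deg (hL : 2 ≤ L) (σ : Config L) : IsPM L σ ↔ ∀ w, deg σ w = 1 := by
  refine forall_congr' fun w => ?_
  have hE1 := E1_ne_zero hL
  have hE2 := E2_ne_zero hL
  have hinc (e : SqEdge L) : (e.1 = w ∨ endpt L e = w) ↔
      e ∈ ({(w, false), (w - E1 L, false), (w, true), (w - E2 L, true)} : Finset (SqEdge L)) := by
    obtain ⟨u, _ | _⟩ := e <;> simp [endpt, eq_sub_iff_add_eq]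
  have hdeg : deg σ w =
      (({(w, false), (w - E1 L, false), (w, true), (w - E2 L, true)} : Finset (SqEdge L)).filter
        (· ∈ σ)).card := by
    rw [Finset.card_filter, Finset.sum_insert, Finset.sum_insert, Finset.sum_insert,
      Finset.sum_singleton]
    · simp only [deg]; push_cast; ring
    all_goals simp [hE1, hE2, eq_sub_iff_add_eq]
  rw [hdeg, Nat.cast_eq_one, Finset.card_eq_one, Finset.singleton_iff_unique_mem]
  simp only [hinc, Finset.mem_filter, and_comm]

theorem IsPM.exactly_one (hL : 2 ≤ L) {σ : Config L} (hσ : IsPM L σ) (w : V L) :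
    ((w, false) ∈ σ ∨ (w - E1 L, false) ∈ σ ∨ (w, true) ∈ σ ∨ (w - E2 L, true) ∈ σ) ∧
      ¬ ((w, false) ∈ σ ∧ (w - E1 L, false) ∈ σ) ∧
      ¬ ((w, false) ∈ σ ∧ (w, true) ∈ σ) ∧ ¬ ((w, false) ∈ σ ∧ (w - E2 L, true) ∈ σ) ∧
      ¬ ((w - E1 L, false) ∈ σ ∧ (w, true) ∈ σ) ∧
      ¬ ((w - E1 L, false) ∈ σ ∧ (w - E2 L, true) ∈ σ) ∧
      ¬ ((w, true) ∈ σ ∧ (w - E2 L, true) ∈ σ) := by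
  have := (isPM_iff_deg hL σ).1 hσ w
  simp only [deg] at this
  split_ifs at this <;> simp_all

theorem deg_flip {σ : Config L} {p q r s : SqEdge L} (hp : p ∈ σ) (hq : q ∈ σ) (hr : r ∉ σ)
    (hs : s ∉ σ) (hpq : p ≠ q) (hrs : r ≠ s) (w : V L) :
    deg ((σ \ {p, q}) ∪ {r, s}) w + deg {p} w + deg {q} w = deg σ w + deg {r} w + deg {s} w := by
  have key (e : SqEdge L) : (if e ∈ (σ \ {p, q}) ∪ {r, s} then (1 : ℤ) else 0) =
      (if e ∈ σ then 1 else 0) - (if e ∈ ({p} : Config L) then 1 else 0) -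
        (if e ∈ ({q} : Config L) then 1 else 0) + (if e ∈ ({r} : Config L) then 1 else 0) +
        (if e ∈ ({s} : Config L) then 1 else 0) := by
    simp only [Finset.mem_union, Finset.mem_sdiff, Finset.mem_insert, Finset.mem_singleton]
    grind
  simp only [deg, key]
  ring

theorem deg_face (v w : V L) :
    deg {(v, false)} w + deg {(v + E2 L, false)} w =
      deg {(v, true)} w + deg {(v + E1 L, true)} w := by
  simp only [deg, Finset.mem_singleton, Prod.mk.injEq, sub_eq_iff_eq_add, and_true, and_false,
    reduceCtorEq, if_false, add_right_comm v (E2 L)]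
  ring

theorem isPM_of_elemMoveAt (hL : 2 ≤ L) {σ σ' : Config L} {v : V L} (hσ : IsPM L σ)
    (h : ElemMoveAt L σ σ' v) : IsPM L σ' := by
  rw [isPM_iff_deg hL] at hσ ⊢
  intro w
  have hE1 := E1_ne_zero hL
  have hE2 := E2_ne_zero hL
  have h₀ := hσ v
  have h₁ := hσ (v + E1 L)
  have h₂ := hσ (v + E2 L)
  have hw := hσ w
  have hface := deg_face v w
  simp only [deg, add_sub_cancel_right] at h₀ h₁ h₂
  rcases h with ⟨hp, hq, rfl⟩ | ⟨hp, hq, rfl⟩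
  · have := deg_flip hp hq (r := (v, true)) (s := (v + E1 L, true))
      (by grind)
      (by grind)
      (by simpa using hE2) (by simpa using hE1) w
    linarith
  · have := deg_flip hp hq (r := (v, false)) (s := (v + E2 L, false))
      (by grind)
      (by grind)
      (by simpa using hE1) (by simpa using hE2) w
    linarith

/-- The number of beads in the column `c` when `c` is even. -/
def crossings [NeZero L] (σ : Config L) (c : ZMod (2 * L)) : ℤ :=
  ∑ a : ZMod L, ((if ((a, c), false) ∈ σ then 1 else 0) + if ((a, c + 1), true) ∈ σ then 1 else 0)

theorem crossings_add_crossings_sub_one [NeZero L] (hL : 2 ≤ L) {σ : Config L} (hσ : IsPM L σ)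
    (c : ZMod (2 * L)) : crossings σ c + crossings σ (c - 1) = L := by
  have h : ∑ a : ZMod L, deg σ (a, c) = L := by
    simp [(isPM_iff_deg hL σ).1 hσ]
  have hshift := Equiv.sum_comp (Equiv.subRight (1 : ZMod L))
    fun a => if ((a, c + 1), true) ∈ σ then (1 : ℤ) else 0
  simp only [Equiv.subRight_apply] at hshift
  simp only [deg, E1, E2, Prod.mk_sub_mk, sub_zero, sub_neg_eq_add, Finset.sum_add_distrib] at h
  simp only [crossings, Finset.sum_add_distrib, sub_add_cancel]
  linarith

theorem crossings_add_two_mul [NeZero L] (hL : 2 ≤ L) {σ : Config L} (hσ : IsPM L σ) (k : ℕ)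
    (c : ZMod (2 * L)) : crossings σ (c + 2 * k) = crossings σ c := by
  induction k with
  | zero => simp
  | succ k ih =>
    have h₁ := crossings_add_crossings_sub_one hL hσ (c + 2 * k + 1)
    have h₂ := crossings_add_crossings_sub_one hL hσ (c + 2 * k + 1 + 1)
    rw [add_sub_cancel_right] at h₁ h₂
    have : c + 2 * ((k + 1 : ℕ) : ZMod (2 * L)) = c + 2 * k + 1 + 1 := by push_cast; ring
    rw [this]
    linarith

end Dimers

section Torus

theorem even_val_add_one [NeZero (2 * L)] (c : ZMod (2 * L)) :
    Even (c + 1).val ↔ ¬ Even c.val := by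
  have h : 1 < 2 * L := by have := NeZero.ne (2 * L); omega
  rw [ZMod.val_add, ZMod.val_one'' (by omega), Nat.even_iff, Nat.even_iff, Nat.mod_mul_right_mod]
  omega

theorem even_val_sub_one [NeZero (2 * L)] (c : ZMod (2 * L)) :
    Even (c - 1).val ↔ ¬ Even c.val := by
  have := even_val_add_one L (c - 1)
  rw [sub_add_cancel] at this
  tauto

variable [NeZero (2 * L)]

theorem even_add_E1 (v : V L) : Even (v + E1 L).2.val ↔ ¬ Even v.2.val :=
  even_val_add_one L v.2

theorem even_add_E2 (v : V L) : Even (v + E2 L).2.val ↔ ¬ Even v.2.val := by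
  simpa [E2, ← sub_eq_add_neg] using even_val_sub_one L v.2

variable {L} in
/-- Translation by `a` on the even faces and by `b` on the odd ones, where `a` and `b` exchange
the two parities. -/
def alternatingShift {a b : V L} (ha : ∀ v : V L, Even (v + a).2.val ↔ ¬ Even v.2.val)
    (hb : ∀ v : V L, Even (v + b).2.val ↔ ¬ Even v.2.val) : Equiv.Perm (V L) where
  toFun v := if Even v.2.val then v + a else v + b
  invFun v := if Even v.2.val then v - b else v - a
  left_inv v := by
    by_cases h : Even v.2.val <;> simp only [h, ha, hb, if_true, if_false, not_true,
      not_false_eq_true, add_sub_cancel_right]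
  right_inv v := by
    have h₁ := ha (v - a)
    have h₂ := hb (v - b)
    rw [sub_add_cancel] at h₁ h₂
    by_cases h : Even v.2.val
    · simp only [h, if_true, if_neg (h₂.1 h), sub_add_cancel]
    · simp only [h, if_false, if_pos (not_not.1 (mt h₁.2 h)), sub_add_cancel]

/-- The column structure of the torus. -/
def torusSystem : BeadSystem (V L) (SqEdge L) where
  next := alternatingShift (even_add_E1 L) (even_add_E2 L)
  T v := if Even v.2.val then (v, false) else (v, true)
  S v := if Even v.2.val then (v + E2 L, false) else (v + E1 L, true)
  S' v := if Even v.2.val then (v, true) else (v, false)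

variable {L}

theorem torusSystem_next (v : V L) :
    (torusSystem L).next v = if Even v.2.val then v + E1 L else v + E2 L := rfl

theorem torusSystem_T (v : V L) :
    (torusSystem L).T v = if Even v.2.val then (v, false) else (v, true) := rfl

theorem torusSystem_S (v : V L) :
    (torusSystem L).S v = if Even v.2.val then (v + E2 L, false) else (v + E1 L, true) := rfl

theorem torusSystem_S' (v : V L) :
    (torusSystem L).S' v = if Even v.2.val then (v, true) else (v, false) := rfl

theorem admissible_of_isPM (hL : 2 ≤ L) {σ : Config L} (hσ : IsPM L σ) :
    (torusSystem L).Admissible σ := by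
  have h := hσ.exactly_one hL
  have h₀ (x : V L) := h x
  have h₁ (x : V L) := h (x + E1 L)
  have h₂ (x : V L) := h (x + E2 L)
  have h₃ (x : V L) := h (x + E1 L + E2 L)
  have hcomm (x : V L) : x + E2 L + E1 L = x + E1 L + E2 L := add_right_comm _ _ _
  have hcomm' (x : V L) : x + E1 L + E2 L - E1 L = x + E2 L := by abel
  simp only [add_sub_cancel_right, hcomm'] at h₀ h₁ h₂ h₃
  constructor <;> intro x <;> by_cases hx : Even x.2.val <;>
    simp only [torusSystem_next, torusSystem_T, torusSystem_S, torusSystem_S', even_add_E1,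
      even_add_E2, hx, if_true, if_false, not_true, not_false_eq_true, hcomm]
  · have := h₃ x; clear h₀ h₁ h₂ h₃; grind only
  · have := h₃ x; clear h₀ h₁ h₂ h₃; grind only
  · have := h₁ x; clear h₀ h₁ h₂ h₃; grind only
  · have := h₂ x; clear h₀ h₁ h₂ h₃; grind only
  · have := h₃ x; clear h₀ h₁ h₂ h₃; grind only
  · have := h₃ x; clear h₀ h₁ h₂ h₃; grind only
  · have := h₃ x; clear h₀ h₁ h₂ h₃; grind only
  · have := h₃ x; clear h₀ h₁ h₂ h₃; grind only
  · have := h₀ x; clear h₀ h₁ h₂ h₃; grind only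
  · have := h₀ x; clear h₀ h₁ h₂ h₃; grind only
  · have := h₁ x; clear h₀ h₁ h₂ h₃; grind only
  · have := h₂ x; clear h₀ h₁ h₂ h₃; grind only
  · have := h₃ x; clear h₀ h₁ h₂ h₃; grind only
  · have := h₃ x; clear h₀ h₁ h₂ h₃; grind only
  · have := h₂ x; clear h₀ h₁ h₂ h₃; grind only
  · have := h₁ x; clear h₀ h₁ h₂ h₃; grind only

theorem upStep_iff {σ σ' : Config L} {e e' : SqEdge L} :
    UpStep L σ e σ' e' ↔ ∃ v, e = (torusSystem L).T v ∧ (torusSystem L).T v ∈ σ ∧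
      (torusSystem L).S v ∈ σ ∧ e' = (torusSystem L).T ((torusSystem L).next v) ∧
      σ' = (σ \ {(torusSystem L).T v, (torusSystem L).S v}) ∪
        {(torusSystem L).S' v, (torusSystem L).T ((torusSystem L).next v)} := by
  simp only [UpStep, ← exists_or]
  refine exists_congr fun v => ?_
  by_cases hv : Even v.2.val <;>
    simp only [torusSystem_next, torusSystem_T, torusSystem_S, torusSystem_S', even_add_E1,
      even_add_E2, hv, ← Nat.not_even_iff_odd, if_true, if_false, not_true, not_false_eq_true,
      true_and, false_and, or_false, false_or]

theorem elemMoveAt_iff {σ σ' : Config L} {v : V L} :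
    ElemMoveAt L σ σ' v ↔
      ((torusSystem L).T v ∈ σ ∧ (torusSystem L).S v ∈ σ ∧
        σ' = (σ \ {(torusSystem L).T v, (torusSystem L).S v}) ∪
          {(torusSystem L).S' v, (torusSystem L).T ((torusSystem L).next v)}) ∨
      ((torusSystem L).S' v ∈ σ ∧ (torusSystem L).T ((torusSystem L).next v) ∈ σ ∧
        σ' = (σ \ {(torusSystem L).S' v, (torusSystem L).T ((torusSystem L).next v)}) ∪
          {(torusSystem L).T v, (torusSystem L).S v}) := by
  by_cases hv : Even v.2.val <;>
    simp only [ElemMoveAt, torusSystem_next, torusSystem_T, torusSystem_S, torusSystem_S',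
      even_add_E1, even_add_E2, hv, if_true, if_false, not_true, not_false_eq_true]
  exact or_comm

theorem torusSystem_T_injective : Function.Injective (torusSystem L).T := by
  intro x y h
  simp only [torusSystem_T] at h
  split_ifs at h <;> simp_all

theorem torusSystem_S_injective : Function.Injective (torusSystem L).S := by
  intro x y h
  simp only [torusSystem_S] at h
  split_ifs at h <;> simp_all

theorem torusSystem_S'_injective : Function.Injective (torusSystem L).S' := by
  intro x y h
  simp only [torusSystem_S'] at h
  split_ifs at h <;> simp_all

theorem torusSystem_S_ne_T (x y : V L) : (torusSystem L).S x ≠ (torusSystem L).T y := by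
  intro h
  have h₁ := even_add_E1 L x
  have h₂ := even_add_E2 L x
  simp only [torusSystem_S, torusSystem_T] at h
  split_ifs at h <;> simp only [Prod.mk.injEq, and_true, and_false, reduceCtorEq] at h <;>
    subst h <;> tauto

theorem torusSystem_S'_ne_T (x y : V L) : (torusSystem L).S' x ≠ (torusSystem L).T y := by
  intro h
  simp only [torusSystem_S', torusSystem_T] at h
  split_ifs at h <;> simp only [Prod.mk.injEq, and_true, and_false, reduceCtorEq] at h <;>
    subst h <;> contradiction

/-- The smaller of the two values of `a - b` in the column of the face `F(a,b)`. -/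
def column (v : V L) : ZMod (2 * L) := if Even v.2.val then v.2 else v.2 - 1

theorem column_next (v : V L) : column ((torusSystem L).next v) = column v := by
  by_cases hv : Even v.2.val <;>
    simp only [column, torusSystem_next, even_add_E1, even_add_E2, hv, if_true, if_false, not_true,
      not_false_eq_true]
  · simp [E1]
  · simp [E2, sub_eq_add_neg]

theorem even_val_column (v : V L) : Even (column v).val := by
  by_cases hv : Even v.2.val
  · rwa [column, if_pos hv]
  · rwa [column, if_neg hv, even_val_sub_one]

theorem column_eq_of_sameCycle [NeZero L] {v w : V L} (h : (torusSystem L).next.SameCycle v w) :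
    column v = column w := by
  obtain ⟨k, -, -, rfl⟩ := h.exists_pow_eq'
  induction k with
  | zero => rfl
  | succ k ih =>
    rw [pow_succ', Equiv.Perm.mul_apply, column_next]
    exact ih ((Equiv.Perm.sameCycle_pow_right).2 (.refl _ _))

theorem torusSystem_S_ne_S' (hL : 2 ≤ L) {x y : V L} (h : column x = column y) :
    (torusSystem L).S x ≠ (torusSystem L).S' y := by
  intro he
  have h2 := two_ne_zero_zmod hL
  have h₁ := even_add_E1 L x
  have h₂ := even_add_E2 L x
  simp only [torusSystem_S, torusSystem_S', column] at h he
  split_ifs at h he with hx hy hy <;>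
    simp only [Prod.mk.injEq, and_true, and_false, reduceCtorEq] at he <;> subst he
  · refine h2 ?_
    simp only [E2, Prod.snd_add] at h
    linear_combination h
  · refine h2 ?_
    simp only [E1, Prod.snd_add] at h
    linear_combination -h

theorem sameCycle_add_natCast (v : V L) (k : ℕ) :
    (torusSystem L).next.SameCycle v (v + ((k : ZMod L), 0)) := by
  induction k with
  | zero =>
    have : v + (((0 : ℕ) : ZMod L), 0) = v := by ext <;> simp
    rw [this]
  | succ k ih =>
    refine ih.trans ?_
    have h2 (u : V L) : u + (1, 0) = (torusSystem L).next ((torusSystem L).next u) := by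
      by_cases hu : Even u.2.val <;>
        simp only [torusSystem_next, even_add_E1, even_add_E2, hu, if_true, if_false, not_true,
          not_false_eq_true] <;> simp [E1, E2, add_assoc]
    have : v + (((k + 1 : ℕ) : ZMod L), 0) = v + ((k : ZMod L), 0) + (1, 0) := by
      simp [add_assoc]
    rw [this, h2]
    simp [Equiv.Perm.SameCycle.refl]

theorem sameCycle_of_column_eq [NeZero L] {v w : V L} (h : column v = column w) :
    (torusSystem L).next.SameCycle v w := by
  have key (u : V L) : (torusSystem L).next.SameCycle (u.1, column u) u := by
    by_cases hu : Even u.2.val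
    · simp [column, hu, Equiv.Perm.SameCycle.refl]
    · have : (torusSystem L).next (u.1, column u) = u := by
        rw [torusSystem_next, if_pos (even_val_column u)]
        simp [column, hu, E1]
      have h' := (Equiv.Perm.sameCycle_apply_right (f := (torusSystem L).next)).2
        (Equiv.Perm.SameCycle.refl _ (u.1, column u))
      rwa [this] at h'
  refine (key v).symm.trans (.trans ?_ (key w))
  have := sameCycle_add_natCast (v.1, column v) (w.1 - v.1).val
  simpa [h] using this

theorem crossings_column [NeZero L] (hL : 2 ≤ L) {σ : Config L} (hσ : IsPM L σ) (v : V L) :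
    crossings σ (column v) = crossings σ 0 := by
  obtain ⟨k, hk⟩ := even_iff_exists_two_mul.1 (even_val_column v)
  have h := crossings_add_two_mul hL hσ k 0
  have hcast : (2 * k : ZMod (2 * L)) = column v := by
    have := ZMod.natCast_zmod_val (column v)
    rw [hk] at this
    exact_mod_cast this
  rwa [zero_add, hcast] at h

theorem crossings_column_pos_iff [NeZero L] (σ : Config L) (v : V L) :
    0 < crossings σ (column v) ↔ ∃ w, column v = column w ∧ (torusSystem L).T w ∈ σ := by
  have hpos (a : ZMod L) : 0 ≤ (if ((a, column v), false) ∈ σ then (1 : ℤ) else 0) +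
      if ((a, column v + 1), true) ∈ σ then 1 else 0 := by positivity
  have hv := even_val_column v
  have hv' : ¬ Even (column v + 1).val := by rw [even_val_add_one]; exact not_not.2 hv
  rw [crossings, Finset.sum_pos_iff_of_nonneg fun a _ => hpos a]
  constructor
  · rintro ⟨a, -, ha⟩
    by_cases h : ((a, column v), false) ∈ σ
    · exact ⟨(a, column v), (if_pos hv).symm, by rwa [torusSystem_T, if_pos hv]⟩
    · have h' : ((a, column v + 1), true) ∈ σ := by
        by_contra h'
        simp [h, h'] at ha
      exact ⟨(a, column v + 1), ((if_neg hv').trans (add_sub_cancel_right _ _)).symm,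
        by rwa [torusSystem_T, if_neg hv']⟩
  · rintro ⟨w, hw, hT⟩
    refine ⟨w.1, Finset.mem_univ _, ?_⟩
    rw [hw]
    by_cases h : Even w.2.val
    · have : ((w.1, column w), false) ∈ σ := by simpa [torusSystem_T, column, h] using hT
      simp only [this, if_true]
      positivity
    · have : ((w.1, column w + 1), true) ∈ σ := by simpa [torusSystem_T, column, h] using hT
      simp only [this, if_true]
      positivity

theorem exists_bead_sameCycle [NeZero L] (hL : 2 ≤ L) {σ : Config L} (hσ : IsPM L σ) {u : V L}
    (hu : (torusSystem L).T u ∈ σ) (v : V L) :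
    ∃ w, (torusSystem L).next.SameCycle v w ∧ (torusSystem L).T w ∈ σ := by
  have h := (crossings_column_pos_iff σ u).2 ⟨u, rfl, hu⟩
  rw [crossings_column hL hσ, ← crossings_column hL hσ v, crossings_column_pos_iff] at h
  obtain ⟨w, hw, hT⟩ := h
  exact ⟨w, sameCycle_of_column_eq hw, hT⟩

theorem card_S_mem_eq_dual [NeZero L] (σ : Config L) :
    ({x | (torusSystem L).S x ∈ σ} : Finset (V L)).card =
      ({x | (torusSystem L).dual.S x ∈ σ} : Finset (V L)).card := by
  refine Finset.card_equiv
    ((alternatingShift (even_add_E2 L) (even_add_E1 L)).trans (torusSystem L).next) fun x => ?_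
  have : (torusSystem L).S' (alternatingShift (even_add_E2 L) (even_add_E1 L) x) =
      (torusSystem L).S x := by
    by_cases hx : Even x.2.val <;>
      simp [torusSystem_S, torusSystem_S', alternatingShift, hx, even_add_E1, even_add_E2,
        -Prod.snd_add]
  simp only [Finset.mem_filter, Finset.mem_univ, true_and]
  simp [BeadSystem.dual, this]

theorem isBeadPos_iff (e : SqEdge L) : IsBeadPos L e ↔ e ∈ Set.range (torusSystem L).T := by
  obtain ⟨v, b⟩ := e
  constructor
  · intro h
    refine ⟨v, ?_⟩
    cases b <;> simp_all [IsBeadPos, torusSystem_T]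
  · rintro ⟨w, hw⟩
    rw [← hw, torusSystem_T]
    split_ifs with h <;> simpa [IsBeadPos] using h

theorem isStep_up [NeZero L] (hL : 2 ≤ L) : (torusSystem L).IsStep (IsPM L)
    (fun p q => UpStep L p.1 p.2 q.1 q.2) where
  admissible _ := admissible_of_isPM hL
  T_injective := torusSystem_T_injective
  S_injective := torusSystem_S_injective
  S_ne_T := torusSystem_S_ne_T
  S_ne_S' _ _ h := torusSystem_S_ne_S' hL (column_eq_of_sameCycle h)
  of_step h := by
    obtain ⟨v, he, -, hS, he', rfl⟩ := upStep_iff.1 h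
    refine ⟨v, he, hS, he', fun f hf => ?_⟩
    simp only [Finset.mem_union, Finset.mem_sdiff, Finset.mem_insert, Finset.mem_singleton] at hf
    tauto
  exists_step {σ v} hσ hT hS := by
    refine ⟨_, upStep_iff.2 ⟨v, rfl, hT, hS, rfl, rfl⟩,
      isPM_of_elemMoveAt hL hσ (elemMoveAt_iff.2 (.inl ⟨hT, hS, rfl⟩)), by simp, ?_⟩
    intro f hf h₁ h₂
    simp [hf, h₁, h₂]

theorem isStep_down [NeZero L] (hL : 2 ≤ L) : (torusSystem L).dual.IsStep (IsPM L)
    (fun p q => DownStep L p.1 p.2 q.1 q.2) where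
  admissible _ hσ := (admissible_of_isPM hL hσ).dual
  T_injective := torusSystem_T_injective
  S_injective := torusSystem_S'_injective.comp (torusSystem L).next.symm.injective
  S_ne_T _ := torusSystem_S'_ne_T _
  S_ne_S' x y h he := by
    have h : (torusSystem L).next.SameCycle x y := Equiv.Perm.sameCycle_inv.1 h
    have h' : (torusSystem L).next.SameCycle ((torusSystem L).next.symm y)
        ((torusSystem L).next.symm x) := by
      rw [← Equiv.Perm.sameCycle_apply_left, ← Equiv.Perm.sameCycle_apply_right]
      simpa using h.symm
    exact torusSystem_S_ne_S' hL (column_eq_of_sameCycle h') he.symm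
  of_step h := by
    obtain ⟨v, he, hT, hS, he', rfl⟩ := upStep_iff.1 h
    refine ⟨(torusSystem L).next v, ?_⟩
    simp only [BeadSystem.dual, Equiv.symm_apply_apply]
    refine ⟨he', by simp, he, fun f hf => ?_⟩
    simp only [Finset.mem_union, Finset.mem_sdiff, Finset.mem_insert, Finset.mem_singleton]
    tauto
  exists_step {σ w} hσ hT hS := by
    obtain ⟨v, rfl⟩ := (torusSystem L).next.surjective w
    simp only [BeadSystem.dual, Equiv.symm_apply_apply] at hT hS ⊢
    have hadm := admissible_of_isPM hL hσ
    have hT' := hadm.not_T_T v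
    have hS' := hadm.not_T_S v
    refine ⟨_, ?_, isPM_of_elemMoveAt hL hσ (elemMoveAt_iff.2 (.inr ⟨hS, hT, rfl⟩)), by simp, ?_⟩
    · refine upStep_iff.2 ⟨v, rfl, by simp, by simp, rfl, ?_⟩
      ext f
      simp only [Finset.mem_union, Finset.mem_sdiff, Finset.mem_insert, Finset.mem_singleton]
      grind
    · intro f hf h₁ h₂
      simp [hf, h₁, h₂]

end Torus

section Charge

variable {L}

theorem upPath_iff {σ σ' : Config L} {e f : SqEdge L} : UpPath L σ e f σ' ↔
    Relation.ReflTransGen (fun p q : Config L × SqEdge L => UpStep L p.1 p.2 q.1 q.2)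
      (σ, e) (σ', f) := by
  constructor
  · intro h
    induction h with
    | refl => exact .refl
    | step h _ ih => exact .head h ih
  · suffices ∀ p q : Config L × SqEdge L,
        Relation.ReflTransGen (fun p q : Config L × SqEdge L => UpStep L p.1 p.2 q.1 q.2) p q →
          UpPath L p.1 p.2 q.2 q.1 from this (σ, e) (σ', f)
    intro p q h
    induction h using Relation.ReflTransGen.head_induction_on with
    | refl => exact .refl _ _
    | head h _ ih => exact .step h ih

theorem downPath_iff {σ σ' : Config L} {e f : SqEdge L} : DownPath L σ e f σ' ↔
    Relation.ReflTransGen (fun p q : Config L × SqEdge L => DownStep L p.1 p.2 q.1 q.2)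
      (σ, e) (σ', f) := by
  constructor
  · intro h
    induction h with
    | refl => exact .refl
    | step h _ ih => exact .head h ih
  · suffices ∀ p q : Config L × SqEdge L,
        Relation.ReflTransGen (fun p q : Config L × SqEdge L => DownStep L p.1 p.2 q.1 q.2) p q →
          DownPath L p.1 p.2 q.2 q.1 from this (σ, e) (σ', f)
    intro p q h
    induction h using Relation.ReflTransGen.head_induction_on with
    | refl => exact .refl _ _
    | head h _ ih => exact .step h ih

/-- Every perfect matching of the torus has charge zero. -/
theorem charge_eq_zero [NeZero L] [NeZero (2 * L)] (hL : 2 ≤ L) {σ : Config L} (hσ : IsPM L σ) :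
    ∑ b ∈ beads L σ, (((Iplus L σ b).ncard : ℤ) - ((Iminus L σ b).ncard : ℤ)) = 0 := by
  classical
  have hbeads : beads L σ = σ.filter (· ∈ Set.range (torusSystem L).T) :=
    Finset.filter_congr fun e _ => isBeadPos_iff e
  rcases (beads L σ).eq_empty_or_nonempty with h | ⟨e, he⟩
  · rw [h, Finset.sum_empty]
  · rw [hbeads] at he
    obtain ⟨he, u, rfl⟩ := Finset.mem_filter.1 he
    have hup := (isStep_up hL).sum_ncard_path hσ
    have hdown := (isStep_down hL).sum_ncard_path hσ
    simp only [← upPath_iff] at hup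
    simp only [← downPath_iff] at hdown
    have hcard := BeadSystem.card_crossed_eq_dual (admissible_of_isPM hL hσ)
      (exists_bead_sameCycle hL hσ he) (by convert card_S_mem_eq_dual σ)
    rw [Finset.sum_sub_distrib, sub_eq_zero, hbeads, ← Nat.cast_sum, ← Nat.cast_sum]
    refine congrArg _ (Eq.trans ?_ (hup.trans (hcard.trans (hdown.symm.trans ?_))))
    · exact Finset.sum_congr (by ext; simp only [Finset.mem_filter]) fun _ _ => rfl
    · exact Finset.sum_congr (by ext; simp only [Finset.mem_filter]; rfl) fun _ _ => rfl

end Charge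

/-- Let `L ≥ 3` and let `σ` be a perfect matching of the square-lattice
torus `G_L`.  If `σ'` is obtained from `σ` by an elementary move at a face carrying two
opposite dimers, then `∑_beads (|I⁺_b| − |I⁻_b|)` is unchanged. -/
theorem elemMove_preserves_charge [NeZero L] [NeZero (2 * L)] (hL : 3 ≤ L)
    (σ σ' : Config L) (hσ : IsPM L σ) (v : V L) (hmove : ElemMoveAt L σ σ' v) :
    ∑ b ∈ beads L σ', (((Iplus L σ' b).ncard : ℤ) - ((Iminus L σ' b).ncard : ℤ)) =
    ∑ b ∈ beads L σ, (((Iplus L σ b).ncard : ℤ) - ((Iminus L σ b).ncard : ℤ)) := by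
  rw [charge_eq_zero (by omega) (isPM_of_elemMoveAt (by omega) hσ hmove),
    charge_eq_zero (by omega) hσ]

end SqDimer
end
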